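/- arXiv:2003.14057 — 5 statements merged into one kernel-verified Lean document; each statement's English description precedes it below -/
import Mathlib

section
/- Let q be a prime power, M ≥ 2 an integer, and d > 1 an integer. Then the number N_M(q,d) of monic irreducible M-power polynomials of degree d over F_q satisfies N_M(q,d) = (1/d) · Σ_{r ∣ d} μ(r) · gcd(M(q^{d/r} − 1), q^d − 1) / gcd(M, q^d − 1), where μ is the Möbius function and the sum is over positive divisors r of d. -/
open Polynomial

/-- In a finite cyclic group, the number of `M`-th powers killed by `N`, up to the factor
`gcd(M, |G|)`. -/
theorem IsCyclic.card_ker_powMonoidHom_range_mul_gcd (G : Type*) [CommGroup G] [IsCyclic G]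
    [Finite G] (M N : ℕ) :
    Nat.card (powMonoidHom N : (powMonoidHom M : G →* G).range →* _).ker *
      Nat.gcd M (Nat.card G) = Nat.gcd (M * N) (Nat.card G) := by
  rw [IsCyclic.card_powMonoidHom_ker, IsCyclic.card_powMonoidHom_range,
    Nat.gcd_comm M, ← Nat.gcd_mul_right, Nat.div_mul_cancel (Nat.gcd_dvd_left _ _),
    ← Nat.gcd_mul_left, ← Nat.gcd_assoc, Nat.gcd_mul_left_right, Nat.gcd_comm, mul_comm N]

theorem FiniteField.exists_aeval_eq_zero_of_natDegree_dvd {F K : Type*} [Field F]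
    [Field K] [Finite K] [Algebra F K] {g : F[X]} (hg : Irreducible g)
    (h : g.natDegree ∣ Module.finrank F K) : ∃ x : K, aeval x g = 0 := by
  have : Fact (Irreducible g) := ⟨hg⟩
  have hr : Module.finrank F (AdjoinRoot g) = g.natDegree :=
    finrank_quotient_span_eq_natDegree
  obtain ⟨φ⟩ := FiniteField.nonempty_algHom_of_finrank_dvd (F := F) (K := AdjoinRoot g) (L := K)
    (hr ▸ h)
  exact ⟨φ (AdjoinRoot.root g), by simp [aeval_algHom_apply, AdjoinRoot.aeval_eq]⟩

section FiniteField

variable {F K : Type*} [Field F] [Finite F] [Field K] [Finite K] [Algebra F K]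

theorem FiniteField.natDegree_minpoly_dvd_iff (x : K) (n : ℕ) :
    (minpoly F x).natDegree ∣ n ↔ x ^ Nat.card F ^ n = x := by
  have hirr := minpoly.irreducible (Algebra.IsIntegral.isIntegral (R := F) x)
  rw [hirr.natDegree_dvd_iff_dvd_X_pow_card_pow_sub_X, minpoly.dvd_iff]
  simp [sub_eq_zero]

/-- The irreducible polynomials `f ≠ X` of degree `[K : F]` such that `f(X^M)` has a factor of
the same degree are the minimal polynomials of the generators of `K` that are nonzero
`M`-th powers. -/
theorem FiniteField.setOf_isPower_eq_image_minpoly {M : ℕ} (hM : M ≠ 0) :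
    {f : F[X] | f.Monic ∧ Irreducible f ∧ f ≠ X ∧ f.natDegree = Module.finrank F K ∧
        ∃ g : F[X], Irreducible g ∧ g ∣ f.comp (X ^ M) ∧ g.natDegree = f.natDegree} =
      (fun h : (powMonoidHom M : Kˣ →* Kˣ).range ↦ minpoly F ((h : Kˣ) : K)) ''
        {h | (minpoly F ((h : Kˣ) : K)).natDegree = Module.finrank F K} := by
  ext f
  constructor
  · rintro ⟨hmon, hirr, hX, hdeg, g, hg, hgf, hgdeg⟩
    obtain ⟨β, hβ⟩ := exists_aeval_eq_zero_of_natDegree_dvd (K := K) hg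
      (hgdeg.trans hdeg).dvd
    have hroot : aeval (β ^ M) f = 0 := by
      have := aeval_eq_zero_of_dvd_aeval_eq_zero hgf hβ
      simpa [aeval_comp] using this
    have hf := minpoly.eq_of_irreducible_of_monic hirr hroot hmon
    have hβ0 : β ≠ 0 := by
      rintro rfl
      rw [zero_pow hM, minpoly.zero] at hf
      exact hX hf
    refine ⟨⟨Units.mk0 β hβ0 ^ M, ⟨Units.mk0 β hβ0, rfl⟩⟩, ?_, ?_⟩
    · simpa [← hf] using hdeg
    · simpa using hf.symm
  · rintro ⟨⟨_, u, rfl⟩, hdeg, rfl⟩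
    simp only [powMonoidHom_apply, Units.val_pow_eq_pow_val, Set.mem_ofPred_eq] at hdeg ⊢
    have hint (x : K) : IsIntegral F x := Algebra.IsIntegral.isIntegral x
    refine ⟨minpoly.monic (hint _), minpoly.irreducible (hint _), fun hX ↦ ?_, hdeg,
      minpoly F (u : K), minpoly.irreducible (hint _), minpoly.dvd _ _ ?_, ?_⟩
    · have := minpoly.aeval F ((u : K) ^ M)
      rw [hX, aeval_X] at this
      exact pow_ne_zero M u.ne_zero this
    · simp [aeval_comp]
    · refine Nat.dvd_antisymm (hdeg ▸ minpoly.degree_dvd (hint _)) ?_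
      rw [natDegree_minpoly_dvd_iff, ← pow_mul, mul_comm, pow_mul,
        (natDegree_minpoly_dvd_iff _ _).1 dvd_rfl]

/-- The conjugates of a nonzero `M`-th power are nonzero `M`-th powers, and their number is the
degree of the minimal polynomial. -/
theorem FiniteField.ncard_range_powMonoidHom_minpoly_eq (M : ℕ)
    (h₀ : (powMonoidHom M : Kˣ →* Kˣ).range) :
    {h : (powMonoidHom M : Kˣ →* Kˣ).range |
      minpoly F ((h : Kˣ) : K) = minpoly F ((h₀ : Kˣ) : K)}.ncard =
        (minpoly F ((h₀ : Kˣ) : K)).natDegree := by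
  classical
  have hint (x : K) : IsIntegral F x := Algebra.IsIntegral.isIntegral x
  have hsep := PerfectField.separable_of_irreducible (minpoly.irreducible (hint ((h₀ : Kˣ) : K)))
  rw [← card_rootSet_eq_natDegree hsep (Normal.splits inferInstance _), ← Nat.card_eq_fintype_card,
    Nat.card_coe_set_eq,
    ← Set.ncard_image_of_injective _ (Units.val_injective.comp Subtype.val_injective)]
  congr 1
  ext x
  rw [mem_rootSet_of_ne (minpoly.ne_zero (hint _))]
  constructor
  · rintro ⟨h, hh, rfl⟩
    rw [← show minpoly F ((h : Kˣ) : K) = _ from hh]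
    exact minpoly.aeval _ _
  · intro hx
    have hmin := minpoly.eq_of_irreducible_of_monic (minpoly.irreducible (hint _)) hx
      (minpoly.monic (hint _))
    obtain ⟨σ, hσ⟩ := IsConjRoot.exists_algEquiv (K := F) (L := K) hmin.symm
    obtain ⟨⟨_, u, rfl⟩, rfl⟩ : ∃ h, h = h₀ := ⟨h₀, rfl⟩
    have hx : σ ((u : K) ^ M) = x := by simpa using hσ
    refine ⟨⟨Units.map (σ : K →* K) u ^ M, ⟨_, rfl⟩⟩, ?_, ?_⟩
    · simpa [← hx] using hmin.symm
    · simpa using hx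

theorem FiniteField.ncard_isPower_mul_finrank {M : ℕ} (hM : M ≠ 0) :
    {f : F[X] | f.Monic ∧ Irreducible f ∧ f ≠ X ∧ f.natDegree = Module.finrank F K ∧
        ∃ g : F[X], Irreducible g ∧ g ∣ f.comp (X ^ M) ∧ g.natDegree = f.natDegree}.ncard *
      Module.finrank F K =
    {h : (powMonoidHom M : Kˣ →* Kˣ).range |
      (minpoly F ((h : Kˣ) : K)).natDegree = Module.finrank F K}.ncard := by
  classical
  have := Fintype.ofFinite (powMonoidHom M : Kˣ →* Kˣ).range
  rw [setOf_isPower_eq_image_minpoly hM, Set.ncard_eq_toFinset_card', Set.ncard_eq_toFinset_card',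
    Set.toFinset_image, Finset.card_eq_sum_card_image
      (fun h : (powMonoidHom M : Kˣ →* Kˣ).range ↦ minpoly F ((h : Kˣ) : K)),
    ← smul_eq_mul, ← Finset.sum_const]
  refine Finset.sum_congr rfl fun f hf ↦ ?_
  obtain ⟨h₀, hh₀, rfl⟩ := Finset.mem_image.1 hf
  have hdeg : (minpoly F ((h₀ : Kˣ) : K)).natDegree = Module.finrank F K := by simpa using hh₀
  rw [← hdeg]
  refine (ncard_range_powMonoidHom_minpoly_eq M h₀).symm.trans ?_
  rw [Set.ncard_eq_toFinset_card']
  congr 1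
  ext h
  simp only [Set.mem_toFinset, Set.mem_ofPred_eq, Finset.mem_filter]
  exact ⟨fun hh ↦ ⟨by rw [hh], hh⟩, And.right⟩

theorem FiniteField.sum_divisors_ncard_natDegree_minpoly_eq (M n : ℕ) (hn : n ≠ 0) :
    (∑ t ∈ n.divisors, {h : (powMonoidHom M : Kˣ →* Kˣ).range |
      (minpoly F ((h : Kˣ) : K)).natDegree = t}.ncard) * Nat.gcd M (Nat.card K - 1) =
    Nat.gcd (M * (Nat.card F ^ n - 1)) (Nat.card K - 1) := by
  classical
  have := Fintype.ofFinite (powMonoidHom M : Kˣ →* Kˣ).range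
  have hq : Nat.card F ^ n - 1 + 1 = Nat.card F ^ n :=
    Nat.sub_add_cancel (Nat.one_le_pow _ _ Nat.card_pos)
  rw [← Nat.card_units, ← IsCyclic.card_ker_powMonoidHom_range_mul_gcd]
  congr 1
  have hker : Nat.card (powMonoidHom (Nat.card F ^ n - 1) :
      (powMonoidHom M : Kˣ →* Kˣ).range →* _).ker =
      (Finset.univ.filter fun h : (powMonoidHom M : Kˣ →* Kˣ).range ↦
        (minpoly F ((h : Kˣ) : K)).natDegree ∣ n).card := by
    rw [← Fintype.card_subtype, ← Nat.card_eq_fintype_card]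
    refine Nat.card_congr (Equiv.subtypeEquivRight fun h ↦ ?_)
    rw [natDegree_minpoly_dvd_iff, ← hq, pow_succ, mul_eq_right₀ (Units.ne_zero _)]
    simp [MonoidHom.mem_ker, Subtype.ext_iff, Units.ext_iff]
  rw [hker, Finset.card_eq_sum_card_fiberwise (t := n.divisors)
    (f := fun h : (powMonoidHom M : Kˣ →* Kˣ).range ↦ (minpoly F ((h : Kˣ) : K)).natDegree)
    fun h hh ↦ by simpa [hn] using hh]
  refine Finset.sum_congr rfl fun t ht ↦ ?_
  rw [Set.ncard_eq_toFinset_card']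
  congr 1
  ext h
  simp only [Set.mem_toFinset, Set.mem_ofPred_eq, Finset.mem_filter, Finset.mem_univ, true_and]
  exact ⟨fun hh ↦ ⟨hh ▸ Nat.dvd_of_mem_divisors ht, hh⟩, And.right⟩

end FiniteField

/-- For a finite field `F` with `q` elements, `M ≥ 2` and `d > 1`, the number
`N_M(q,d)` of monic irreducible M-power polynomials of degree `d` over `F` (excluding `X`)
equals `(1/d) · Σ_{r ∣ d} μ(r) · gcd(M(q^{d/r} − 1), q^d − 1) / gcd(M, q^d − 1)`. -/
theorem statement0 (F : Type*) [Field F] [Fintype F] (q : ℕ) (hq : q = Fintype.card F)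
    (M : ℕ) (hM : 2 ≤ M) (d : ℕ) (hd : 1 < d) :
    (Set.ncard {f : F[X] | f.Monic ∧ Irreducible f ∧ f ≠ X ∧ f.natDegree = d ∧
        ∃ g : F[X], Irreducible g ∧ g ∣ f.comp (X ^ M) ∧ g.natDegree = f.natDegree} : ℚ) =
      (1 / (d : ℚ)) * ∑ r ∈ d.divisors, (ArithmeticFunction.moebius r : ℚ) *
        ((Nat.gcd (M * (q ^ (d / r) - 1)) (q ^ d - 1) : ℚ) /
          (Nat.gcd M (q ^ d - 1) : ℚ)) := by
  obtain ⟨p, hp⟩ := CharP.exists F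
  have : Fact p.Prime := ⟨CharP.char_is_prime F p⟩
  have : NeZero d := ⟨by omega⟩
  let K := FiniteField.Extension F p d
  have hfin : Module.finrank F K = d := FiniteField.finrank_extension F p d
  have hF : Nat.card F = q := by rw [hq, Nat.card_eq_fintype_card]
  have hK : Nat.card K = q ^ d := hF ▸ FiniteField.natCard_extension F p d
  have hcount := FiniteField.ncard_isPower_mul_finrank (F := F) (K := K) (M := M) (by omega)
  rw [hfin] at hcount
  have hgcd : (Nat.gcd M (q ^ d - 1) : ℚ) ≠ 0 := by
    exact_mod_cast (Nat.gcd_pos_of_pos_left _ (by omega)).ne'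
  have hsum : ∀ n > 0, (∑ t ∈ n.divisors, ({h : (powMonoidHom M : Kˣ →* Kˣ).range |
      (minpoly F ((h : Kˣ) : K)).natDegree = t}.ncard : ℚ)) =
      (Nat.gcd (M * (q ^ n - 1)) (q ^ d - 1) : ℚ) / (Nat.gcd M (q ^ d - 1) : ℚ) := by
    intro n hn
    have := FiniteField.sum_divisors_ncard_natDegree_minpoly_eq (F := F) (K := K) M n hn.ne'
    rw [hF, hK] at this
    rw [eq_div_iff hgcd]
    exact_mod_cast this
  rw [ArithmeticFunction.sum_eq_iff_sum_mul_moebius_eq] at hsum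
  have hinv := hsum d (by omega)
  rw [Nat.sum_divisorsAntidiagonal (fun a b ↦ (ArithmeticFunction.moebius a : ℚ) *
    ((Nat.gcd (M * (q ^ b - 1)) (q ^ d - 1) : ℚ) / (Nat.gcd M (q ^ d - 1) : ℚ)))] at hinv
  rw [hinv, ← hcount]
  have : (d : ℚ) ≠ 0 := by exact_mod_cast NeZero.ne d
  push_cast
  field_simp
end

section
/- Let M be a prime, q a prime power with gcd(q, M) = 1, and f ∈ F_q[X] a monic irreducible polynomial of degree d with f ≠ X. Let s = 𝔪(M;q) be the multiplicative order of q modulo M. Then: (1) if s does not divide d, then f(X^M) factors as a product of one irreducible polynomial of degree d together with d(M−1)/lcm(s,d) irreducible polynomials each of degree lcm(s,d); in particular f is an M-power polynomial; (2) if s divides d, then f(X^M) is either irreducible or has an irreducible factor of degree d (so if f(X^M) is reducible then f is M-power). -/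
open Polynomial

section PowerComposition

variable {F : Type*} [Field F]

theorem Irreducible.natDegree_dvd_iff_pow_eq [Fintype F] {K : Type*} [Field K] [Algebra F K]
    {h : F[X]} (hi : Irreducible h) {x : K} (hx : aeval x h = 0) (n : ℕ) :
    h.natDegree ∣ n ↔ x ^ Fintype.card F ^ n = x := by
  rw [hi.natDegree_dvd_iff_dvd_X_pow_card_pow_sub_X, ← hi.dvd_iff_aeval_eq_zero hx,
    Nat.card_eq_fintype_card]
  simp [sub_eq_zero]

theorem Irreducible.aeval_zero_ne_zero {K : Type*} [Field K] [Algebra F K] {f : F[X]}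
    (hirr : Irreducible f) (hmon : f.Monic) (hfX : f ≠ X) : aeval (0 : K) f ≠ 0 := by
  intro h0
  have hX : f ∣ X := (hirr.dvd_iff_aeval_eq_zero h0).1 (by simp)
  exact hfX (eq_of_monic_of_associated hmon monic_X (hirr.associated_of_dvd irreducible_X hX))

theorem minpoly_dvd_comp_X_pow [Fintype F] {K : Type*} [Field K] [Algebra F K] {f : F[X]}
    (hirr : Irreducible f) {M : ℕ} {x : K} (hx : aeval (x ^ M) f = 0) (hint : IsIntegral F x)
    (hpow : x ^ Fintype.card F ^ f.natDegree = x) :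
    minpoly F x ∣ f.comp (X ^ M) ∧ (minpoly F x).natDegree = f.natDegree := by
  have hmi := minpoly.irreducible hint
  have h0 := minpoly.aeval F x
  refine ⟨minpoly.dvd F x (by simpa [aeval_comp] using hx), Nat.dvd_antisymm ?_ ?_⟩
  · rwa [hmi.natDegree_dvd_iff_pow_eq h0]
  · rw [hirr.natDegree_dvd_iff_pow_eq hx, pow_right_comm,
      (hmi.natDegree_dvd_iff_pow_eq h0 _).1 dvd_rfl]

theorem orderOf_natCast_dvd_iff {M q : ℕ} (hq : 0 < q) (n : ℕ) :
    orderOf (q : ZMod M) ∣ n ↔ M ∣ q ^ n - 1 := by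
  rw [orderOf_dvd_iff_pow_eq_one, ← ZMod.natCast_eq_zero_iff, Nat.cast_sub (Nat.pow_pos hq),
    sub_eq_zero]
  simp

theorem pow_eq_self_iff_pow_sub_one {K : Type*} [Field K] {x : K} (hx : x ≠ 0) {n : ℕ}
    (hn : 0 < n) : x ^ n = x ↔ x ^ (n - 1) = 1 := by
  rw [← mul_eq_right₀ hx (a := x ^ (n - 1)), ← pow_succ, Nat.sub_add_cancel hn]

theorem exists_pow_mul_eq_self {M n : ℕ} (hn : 1 < n) (hco : Nat.Coprime M (n - 1)) :
    ∃ k : ℕ, ∀ {K : Type*} [Field K] (x : K), x ≠ 0 → x ^ n = x → x ^ (k * M) = x := by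
  refine ⟨M ^ (Nat.totient (n - 1) - 1), fun x hx hxn ↦ ?_⟩
  rw [← pow_succ, Nat.sub_add_cancel (Nat.totient_pos.2 (by lia))]
  rw [pow_eq_self_iff_pow_sub_one hx (by lia)] at hxn
  simpa using pow_eq_pow_of_modEq (Nat.ModEq.pow_totient hco) hxn

theorem natDegree_eq_or_eq_lcm [Fintype F] {K : Type*} [Field K] [Algebra F K] {M : ℕ}
    (hM : M.Prime) {f h : F[X]} (hirr : Irreducible f) (hh : Irreducible h) {x y : K} (hy0 : y ≠ 0)
    (hhx : aeval x h = 0) (hfx : aeval (x ^ M) f = 0) (hxy : y ^ M = x ^ M)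
    (hy : y ^ Fintype.card F ^ f.natDegree = y) :
    h.natDegree = f.natDegree ∨
      h.natDegree = Nat.lcm (orderOf (Fintype.card F : ZMod M)) f.natDegree := by
  have hq : 0 < Fintype.card F := Fintype.card_pos
  have hfh : f.natDegree ∣ h.natDegree := by
    rw [hirr.natDegree_dvd_iff_pow_eq hfx, pow_right_comm,
      (hh.natDegree_dvd_iff_pow_eq hhx _).1 dvd_rfl]
  by_cases hxeq : x = y
  · left
    subst hxeq
    exact Nat.dvd_antisymm ((hh.natDegree_dvd_iff_pow_eq hhx _).2 hy) hfh
  right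
  have hz : orderOf (x / y) = M := by
    have := Fact.mk hM
    refine orderOf_eq_prime ?_ ?_
    · rw [div_pow, hxy, div_self (hxy ▸ pow_ne_zero M hy0)]
    · rwa [ne_eq, div_eq_one_iff_eq hy0]
  have hx0 : x ≠ 0 := by
    rintro rfl
    exact pow_ne_zero M hy0 (by simp [hxy, hM.ne_zero])
  have key (n : ℕ) (hn : f.natDegree ∣ n) :
      h.natDegree ∣ n ↔ orderOf (Fintype.card F : ZMod M) ∣ n := by
    have hyn : y ^ Fintype.card F ^ n = y := by
      obtain ⟨m, rfl⟩ := hn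
      rw [pow_mul]
      generalize Fintype.card F ^ f.natDegree = N at hy
      induction m with
      | zero => simp
      | succ m ih => rw [pow_succ, pow_mul, ih, hy]
    rw [orderOf_natCast_dvd_iff hq, ← hz, orderOf_dvd_iff_pow_eq_one,
      ← pow_eq_self_iff_pow_sub_one (div_ne_zero hx0 hy0) (Nat.pow_pos hq), div_pow, hyn,
      div_left_inj' hy0, hh.natDegree_dvd_iff_pow_eq hhx]
  refine Nat.dvd_antisymm ((key _ (Nat.dvd_lcm_right _ _)).2 (Nat.dvd_lcm_left _ _)) ?_
  exact Nat.lcm_dvd ((key _ hfh).1 dvd_rfl) hfh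

theorem eq_of_dvd_comp_of_pow_mul_eq_self {K L : Type*} [Field K] [Algebra F K] [Field L]
    [Algebra F L] {M k : ℕ} {f g h : F[X]} (hirr : Irreducible f) (hg : Irreducible g)
    (hh : Irreducible h) (hgm : g.Monic) (hhm : h.Monic) {x : K} {y : L}
    (hgx : aeval x g = 0) (hhy : aeval y h = 0)
    (hfx : aeval (x ^ M) f = 0) (hfy : aeval (y ^ M) f = 0)
    (hx : x ^ (k * M) = x) (hy : y ^ (k * M) = y) : g = h := by
  have h1 : f ∣ g.comp (X ^ k) := by
    rw [← hirr.dvd_iff_aeval_eq_zero hfx, aeval_comp]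
    simpa [← pow_mul, mul_comm M k, hx] using hgx
  rw [← hirr.dvd_iff_aeval_eq_zero hfy, aeval_comp, map_pow, aeval_X, ← pow_mul, mul_comm M k,
    hy] at h1
  exact (eq_of_monic_of_associated hhm hgm
    (hh.associated_of_dvd hg ((hh.dvd_iff_aeval_eq_zero hhy).1 h1))).symm

theorem squarefree_comp_X_pow [PerfectField F] {M : ℕ} (hM : (M : F) ≠ 0) {f : F[X]}
    (hirr : Irreducible f) (hmon : f.Monic) (hfX : f ≠ X) : Squarefree (f.comp (X ^ M)) := by
  refine Separable.squarefree ?_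
  have hsep : f.Separable := PerfectField.separable_of_irreducible hirr
  have hX : IsCoprime (f.comp (X ^ M)) X := by
    refine (irreducible_X.coprime_iff_not_dvd.2 ?_).symm
    have hM0 : M ≠ 0 := by rintro rfl; simp at hM
    have := hirr.aeval_zero_ne_zero (K := F) hmon hfX
    simpa [X_dvd_iff, coeff_zero_eq_eval_zero, eval_comp, hM0] using this
  have hd : IsCoprime (f.comp (X ^ M)) ((derivative f).comp (X ^ M)) :=
    IsCoprime.map hsep (compRingHom (X ^ M))
  rw [Separable, derivative_comp, derivative_X_pow]
  exact IsCoprime.mul_right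
    ((isCoprime_mul_unit_left_right (isUnit_C.2 hM.isUnit) _ _).2 hX.pow_right) hd

end PowerComposition

/-- Let `M` be a prime with `gcd(q,M) = 1`, `f` monic irreducible of degree
`d` with `f ≠ X`, and `s = 𝔪(M;q)` the multiplicative order of `q` mod `M`. If `s ∤ d` then
`f(X^M)` is a product of one irreducible polynomial of degree `d` and `d(M−1)/lcm(s,d)`
irreducible polynomials each of degree `lcm(s,d)` (so `f` is M-power). If `s ∣ d` then
`f(X^M)` is either irreducible or has an irreducible factor of degree `d`. -/
theorem statement3 (F : Type*) [Field F] [Fintype F] (M : ℕ) (hM : M.Prime)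
    (hcop : Nat.Coprime (Fintype.card F) M)
    (f : F[X]) (hmon : f.Monic) (hirr : Irreducible f) (hfX : f ≠ X)
    (d : ℕ) (hdeg : f.natDegree = d)
    (s : ℕ) (hs : s = orderOf ((Fintype.card F : ZMod M))) :
    (¬ s ∣ d →
      ∃ (g : F[X]) (T : Multiset F[X]),
        g.Monic ∧ Irreducible g ∧ g.natDegree = d ∧
        Multiset.card T = d * (M - 1) / Nat.lcm s d ∧
        (∀ h ∈ T, h.Monic ∧ Irreducible h ∧ h.natDegree = Nat.lcm s d) ∧
        f.comp (X ^ M) = g * T.prod) ∧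
    (s ∣ d →
      Irreducible (f.comp (X ^ M)) ∨
        ∃ g : F[X], Irreducible g ∧ g ∣ f.comp (X ^ M) ∧ g.natDegree = d) := by
  classical
  subst hdeg
  have hq : 1 < Fintype.card F := Fintype.one_lt_card
  have hdpos : 0 < f.natDegree := hirr.natDegree_pos
  refine ⟨fun hsd ↦ ?_, fun _ ↦ ?_⟩
  · have hco : Nat.Coprime M (Fintype.card F ^ f.natDegree - 1) := by
      rwa [hM.coprime_iff_not_dvd, ← orderOf_natCast_dvd_iff hq.le, ← hs]
    obtain ⟨k, hk⟩ := exists_pow_mul_eq_self (Nat.one_lt_pow hdpos.ne' hq) hco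
    have hPm : (f.comp (X ^ M)).Monic := hmon.comp (monic_X_pow M) (by simpa using hM.ne_zero)
    have hP0 := hPm.ne_zero
    have hroot {K : Type _} [Field K] [Algebra F K] {x : K} {p : F[X]} (hx : aeval x p = 0)
        (hp : p ∣ f.comp (X ^ M)) : aeval (x ^ M) f = 0 := by
      obtain ⟨r, hr⟩ := hp
      have := congrArg (aeval x) hr
      simpa [aeval_comp, hx] using this
    have hprim {K : Type _} [Field K] [Algebra F K] {a : K} (ha : aeval a f = 0) :
        a ^ k ≠ 0 ∧ (a ^ k) ^ M = a ∧ (a ^ k) ^ Fintype.card F ^ f.natDegree = a ^ k := by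
      have ha0 : a ≠ 0 := fun h0 ↦ hirr.aeval_zero_ne_zero hmon hfX (h0 ▸ ha)
      have hap := (hirr.natDegree_dvd_iff_pow_eq ha _).1 dvd_rfl
      exact ⟨pow_ne_zero k ha0, by rw [← pow_mul, hk a ha0 hap], by rw [pow_right_comm, hap]⟩
    have := Fact.mk hirr
    let a := AdjoinRoot.root f
    have ha : aeval a f = 0 := AdjoinRoot.eval₂_root f
    obtain ⟨hb0, hbM, hbq⟩ := hprim ha
    have hint : IsIntegral F (a ^ k) := IsIntegral.pow ⟨f, hmon, ha⟩ k
    obtain ⟨hgP, hgd⟩ := minpoly_dvd_comp_X_pow hirr (by rwa [hbM]) hint hbq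
    have hgi := minpoly.irreducible hint
    have hgm := minpoly.monic hint
    set g := minpoly F (a ^ k)
    have hgmem : g ∈ UniqueFactorizationMonoid.normalizedFactors (f.comp (X ^ M)) :=
      (Polynomial.mem_normalizedFactors_iff hP0).2 ⟨hgi, hgm, hgP⟩
    have hMF : (M : F) ≠ 0 := by
      obtain ⟨p, hp⟩ := CharP.exists F
      obtain ⟨n, hpp, hcard⟩ := FiniteField.card F p
      rw [ne_eq, CharP.cast_eq_zero_iff F p, Nat.prime_dvd_prime_iff_eq hpp hM]
      rintro rfl
      exact hpp.ne_one (Nat.Coprime.eq_one_of_dvd hcop.symm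
        (hcard ▸ dvd_pow_self _ n.ne_zero))
    have hnodup := (UniqueFactorizationMonoid.squarefree_iff_nodup_normalizedFactors hP0).1
      (squarefree_comp_X_pow hMF hirr hmon hfX)
    set T := (UniqueFactorizationMonoid.normalizedFactors (f.comp (X ^ M))).erase g
    have hT : ∀ h ∈ T, h.Monic ∧ Irreducible h ∧ h.natDegree = Nat.lcm s f.natDegree := by
      intro h hhT
      obtain ⟨hne, hmem⟩ := hnodup.mem_erase_iff.1 hhT
      obtain ⟨hhi, hhm, hhP⟩ := (Polynomial.mem_normalizedFactors_iff hP0).1 hmem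
      refine ⟨hhm, hhi, ?_⟩
      have := Fact.mk hhi
      have hc : aeval (AdjoinRoot.root h) h = 0 := AdjoinRoot.eval₂_root h
      have hcf := hroot hc hhP
      obtain ⟨hy0, hyM, hyq⟩ := hprim hcf
      rw [hs]
      refine (natDegree_eq_or_eq_lcm hM hirr hhi hy0 hc hcf hyM hyq).resolve_left fun hd ↦ hne ?_
      have hc0 : AdjoinRoot.root h ≠ 0 := by
        intro h0
        rw [h0, zero_pow hM.ne_zero] at hcf
        exact hirr.aeval_zero_ne_zero hmon hfX hcf
      exact eq_of_dvd_comp_of_pow_mul_eq_self hirr hhi hgi hhm hgm hc (minpoly.aeval F (a ^ k))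
        hcf (by rwa [hbM])
        (hk _ hc0 ((hhi.natDegree_dvd_iff_pow_eq hc _).1 hd.dvd)) (hk _ hb0 hbq)
    have hprod : f.comp (X ^ M) = g * T.prod := by
      rw [Multiset.prod_erase hgmem, UniqueFactorizationMonoid.prod_normalizedFactors_eq hP0,
        hPm.normalize_eq_self]
    refine ⟨g, T, hgm, hgi, hgd, ?_, hT, hprod⟩
    have hs0 : 0 < s := by
      have := Fact.mk hM
      have hq0 : (Fintype.card F : ZMod M) ≠ 0 := by
        rw [ne_eq, ZMod.natCast_eq_zero_iff]
        exact (hM.coprime_iff_not_dvd).1 hcop.symm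
      rw [hs]
      exact Nat.pos_of_dvd_of_pos (ZMod.orderOf_dvd_card_sub_one hq0)
        (Nat.sub_pos_of_lt hM.one_lt)
    have hdegs := congrArg natDegree hprod
    have hTm : T.prod.Monic := by
      simpa using monic_multiset_prod_of_monic T id fun h hh ↦ (hT h hh).1
    have hTd : T.prod.natDegree = Multiset.card T * Nat.lcm s f.natDegree := by
      rw [natDegree_multiset_prod_of_monic T fun h hh ↦ (hT h hh).1,
        Multiset.map_congr rfl fun h hh ↦ (hT h hh).2.2]
      simp
    rw [natDegree_comp, natDegree_X_pow, hgm.natDegree_mul hTm, hgd, hTd] at hdegs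
    refine (Nat.div_eq_of_eq_mul_left (Nat.lcm_pos hs0 hdpos) ?_).symm
    rw [Nat.mul_sub, hdegs]
    simp
  · by_contra! hcon
    obtain ⟨hred, hno⟩ := hcon
    refine hred (irreducible_comp hmon (monic_X_pow M) hirr fun E _ _ x hx ↦ ?_)
    have hxi : IsIntegral F x := by
      by_contra h
      exact hmon.ne_zero (hx ▸ minpoly.eq_zero h)
    rw [Polynomial.map_pow, map_X]
    refine X_pow_sub_C_irreducible_of_prime hM fun b hb ↦ ?_
    have := IntermediateField.adjoin.finiteDimensional hxi
    have : Finite (IntermediateField.adjoin F {x}) := Module.finite_of_finite F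
    have := Fintype.ofFinite (IntermediateField.adjoin F {x})
    have hcard : Fintype.card (IntermediateField.adjoin F {x}) =
        Fintype.card F ^ f.natDegree := by
      rw [Module.card_eq_pow_finrank (K := F), IntermediateField.adjoin.finrank hxi, hx]
    have hint : IsIntegral F b := IsIntegral.of_finite F b
    obtain ⟨h1, h2⟩ := minpoly_dvd_comp_X_pow hirr (M := M) (x := b)
      (by rw [hb, ← hx, ← IntermediateField.minpoly_gen F x, minpoly.aeval]) hint
      (by rw [← hcard, FiniteField.pow_card])
    exact hno _ (minpoly.irreducible hint) h1 h2
end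

section
/- Let M ≥ 2 with gcd(q, M) = 1 and let α ∈ GL(n, F_q). Suppose that, viewing F_q^n as an F_q[X]-module with X acting as α, it is isomorphic to ⊕_{i=1}^{l} F_q[X]/(f^{λ_i}) for a single monic irreducible polynomial f ≠ X of degree k and integers λ_1 ≥ λ_2 ≥ … ≥ λ_l ≥ 1 (so n = k·(λ_1+…+λ_l)). Let f_M be the minimal polynomial over F_q of the M-th power of a root of f, say of degree d, and set s = k/d. Then F_q^n, viewed as an F_q[X]-module with X acting as α^M, is isomorphic to ⊕_{i=1}^{l} (F_q[X]/(f_M^{λ_i}))^{⊕ s}. -/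
open Polynomial DirectSum

theorem separable_expand {F : Type*} [Field F] {g : F[X]} (hg : g.Separable)
    (hg0 : ¬ X ∣ g) {M : ℕ} (hM : (M : F) ≠ 0) : (expand F M g).Separable := by
  have hM0 : M ≠ 0 := by rintro rfl; simp at hM
  rw [Polynomial.separable_def, derivative_expand]
  refine IsCoprime.mul_right (IsCoprime.map hg (expand F M : F[X] →ₐ[F] F[X]).toRingHom) ?_
  refine IsCoprime.mul_right ?_ ?_
  · have : IsUnit (M : F[X]) := by
      rw [← C_eq_natCast]; exact Polynomial.isUnit_C.2 hM.isUnit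
    simpa using (isCoprime_mul_unit_left_right this _ 1).2 isCoprime_one_right
  · refine IsCoprime.pow_right (((irreducible_X (R := F)).coprime_iff_not_dvd).2 ?_).symm
    rw [X_dvd_iff] at hg0 ⊢
    rwa [coeff_zero_eq_eval_zero, expand_eval, zero_pow hM0, ← coeff_zero_eq_eval_zero]

theorem exists_generators_mod {F : Type*} [Field F] {E : Type*} [Field E] [Algebra F E] {η : E}
    (hη : IsIntegral F η) (M : ℕ) :
    ∃ s, (minpoly F η).natDegree = (minpoly F (η ^ M)).natDegree * s ∧
      ∃ B : Fin s → F[X], ∀ v : F[X], ∃ p : Fin s → F[X],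
        minpoly F η ∣ v - ∑ j, expand F M (p j) * B j := by
  set θ : IntermediateField.adjoin F {η} := IntermediateField.AdjoinSimple.gen F η
  have hθη : algebraMap (IntermediateField.adjoin F {η}) E θ = η := rfl
  have hθint : IsIntegral F θ := by
    rwa [← isIntegral_algebraMap_iff (algebraMap (IntermediateField.adjoin F {η}) E).injective]
  have hmin : minpoly F (η ^ M) = minpoly F (θ ^ M) := by
    have h := minpoly.algebraMap_eq (A := F)
      (algebraMap (IntermediateField.adjoin F {η}) E).injective (θ ^ M)
    rwa [map_pow, hθη] at h
  have : FiniteDimensional F (IntermediateField.adjoin F {η}) :=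
    IntermediateField.adjoin.finiteDimensional hη
  refine ⟨Module.finrank (IntermediateField.adjoin F {θ ^ M}) (IntermediateField.adjoin F {η}),
    ?_, ?_⟩
  · rw [hmin, ← IntermediateField.adjoin.finrank (hθint.pow M),
      ← IntermediateField.adjoin.finrank hη, Module.finrank_mul_finrank]
  · let b := Module.finBasis (IntermediateField.adjoin F {θ ^ M}) (IntermediateField.adjoin F {η})
    have hpoly (x : IntermediateField.adjoin F {η}) : ∃ p : F[X], aeval η p = x := by
      have := x.2
      rw [← IntermediateField.mem_toSubalgebra,
        IntermediateField.adjoin_simple_toSubalgebra_of_isAlgebraic hη.isAlgebraic,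
        Algebra.adjoin_singleton_eq_range_aeval] at this
      exact this
    have hpoly' (x : IntermediateField.adjoin F {θ ^ M}) :
        ∃ p : F[X], aeval (θ ^ M) p = x := by
      have := x.2
      rw [← IntermediateField.mem_toSubalgebra,
        IntermediateField.adjoin_simple_toSubalgebra_of_isAlgebraic (hθint.pow M).isAlgebraic,
        Algebra.adjoin_singleton_eq_range_aeval] at this
      exact this
    choose B hB using fun j => hpoly (b j)
    refine ⟨B, fun v => ?_⟩
    choose p hp using fun j => hpoly' (b.repr (aeval θ v) j)
    refine ⟨p, minpoly.dvd F η ?_⟩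
    have h := congrArg (algebraMap _ E) (b.sum_repr (aeval θ v))
    rw [← aeval_algebraMap_apply, hθη, map_sum] at h
    rw [map_sub, map_sum, sub_eq_zero, ← h]
    refine Finset.sum_congr rfl fun j _ => ?_
    rw [map_mul, hB, expand_aeval, Algebra.smul_def, map_mul]
    congr 1
    change algebraMap _ E (b.repr (aeval θ v) j : IntermediateField.adjoin F {η}) = _
    rw [← hp, ← aeval_algebraMap_apply, map_pow, hθη]

theorem exists_generators_mod_pow {F : Type*} [Field F] {f g h : F[X]} {M s : ℕ}
    (hgh : expand F M g = f * h) (hfh : IsCoprime f h) {B : Fin s → F[X]}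
    (hB : ∀ v : F[X], ∃ p : Fin s → F[X], f ∣ v - ∑ j, expand F M (p j) * B j)
    (m : ℕ) (v : F[X]) :
    ∃ p : Fin s → F[X], f ^ m ∣ v - ∑ j, expand F M (p j) * B j := by
  induction m with
  | zero => exact ⟨0, by simp⟩
  | succ m ih =>
    obtain ⟨p, w, hw⟩ := ih
    obtain ⟨a, c, hac⟩ := hfh.pow_right (n := m)
    obtain ⟨p', w', hw'⟩ := hB (c * w)
    refine ⟨fun j => p j + g ^ m * p' j, a * w + h ^ m * w', ?_⟩
    have hsum : ∑ j, expand F M (p j + g ^ m * p' j) * B j =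
        ∑ j, expand F M (p j) * B j + (f * h) ^ m * ∑ j, expand F M (p' j) * B j := by
      rw [Finset.mul_sum, ← Finset.sum_add_distrib]
      refine Finset.sum_congr rfl fun j _ => ?_
      rw [map_add, map_mul, map_pow, hgh]
      ring
    rw [hsum, mul_pow]
    linear_combination hw + f ^ m * h ^ m * hw' - f ^ m * w * hac

theorem smul_of_pow {F V : Type*} [Field F] [AddCommGroup V] [Module F V] (φ : Module.End F V)
    (M : ℕ) (p : F[X]) (x : Module.AEval' φ) :
    p • Module.AEval'.of (φ ^ M) ((Module.AEval'.of φ).symm x) =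
      Module.AEval'.of (φ ^ M) ((Module.AEval'.of φ).symm (expand F M p • x)) := by
  obtain ⟨y, rfl⟩ := (Module.AEval'.of φ).surjective x
  rw [LinearEquiv.symm_apply_apply, ← Module.AEval.of_aeval_smul, ← Module.AEval.of_aeval_smul,
    expand_aeval, LinearEquiv.symm_apply_apply]

theorem injective_of_surjective_of_finrank_eq {F R N P : Type*} [Field F] [Ring R] [Algebra F R]
    [AddCommMonoid N] [Module F N] [Module R N] [IsScalarTower F R N]
    [AddCommMonoid P] [Module F P] [Module R P] [IsScalarTower F R P]
    [Module.Finite F N] [Module.Finite F P]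
    (h : Module.finrank F N = Module.finrank F P) {T : N →ₗ[R] P} (hT : Function.Surjective T) :
    Function.Injective T :=
  letI := Module.addCommMonoidToAddCommGroup F (M := N)
  letI := Module.addCommMonoidToAddCommGroup F (M := P)
  (LinearMap.injective_iff_surjective_of_finrank_eq_finrank (f := T.restrictScalars F) h).2 hT

theorem nonempty_aeval_pow_equiv {F V : Type*} [Field F] [AddCommGroup V] [Module F V]
    [FiniteDimensional F V] (φ : Module.End F V) {f g h : F[X]} {M l s : ℕ} (lam : Fin l → ℕ)
    (hf : f ≠ 0) (hg : g ≠ 0) (hdeg : f.natDegree = g.natDegree * s)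
    (hgh : expand F M g = f * h)
    (e : Module.AEval' φ ≃ₗ[F[X]] ⨁ i : Fin l, F[X] ⧸ Ideal.span {f ^ lam i})
    {B : Fin s → F[X]}
    (hB : ∀ (m : ℕ) (v : F[X]), ∃ p : Fin s → F[X],
      f ^ m ∣ v - ∑ j, expand F M (p j) * B j) :
    Nonempty (Module.AEval' (φ ^ M) ≃ₗ[F[X]]
      ⨁ p : Fin l × Fin s, F[X] ⧸ Ideal.span {g ^ lam p.1}) := by
  let c := (Module.AEval'.of φ).symm ≪≫ₗ Module.AEval'.of (φ ^ M)
  have hc (p : F[X]) (x : Module.AEval' φ) : p • c x = c (expand F M p • x) := smul_of_pow φ M p x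
  let ι (i : Fin l) : F[X] →ₗ[F[X]] ⨁ i : Fin l, F[X] ⧸ Ideal.span {f ^ lam i} :=
    lof F[X] (Fin l) (fun i => F[X] ⧸ Ideal.span {f ^ lam i}) i ∘ₗ Submodule.mkQ _
  have hι (i : Fin l) (v : F[X]) (hv : f ^ lam i ∣ v) : ι i v = 0 := by
    have : Submodule.mkQ (Ideal.span {f ^ lam i}) v = 0 := by
      rw [Submodule.mkQ_apply, Submodule.Quotient.mk_eq_zero, Ideal.mem_span_singleton]
      exact hv
    rw [LinearMap.comp_apply, this, map_zero]
  let b (q : Fin l × Fin s) : Module.AEval' (φ ^ M) := c (e.symm (ι q.1 (B q.2)))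
  have hb (q : Fin l × Fin s) (p : F[X]) :
      p • b q = c (e.symm (ι q.1 (expand F M p * B q.2))) := by
    rw [hc, ← map_smul, ← map_smul, smul_eq_mul]
  let T : (⨁ q : Fin l × Fin s, F[X] ⧸ Ideal.span {g ^ lam q.1}) →ₗ[F[X]]
      Module.AEval' (φ ^ M) :=
    toModule F[X] _ _ fun q =>
      Submodule.liftQ (Ideal.span {g ^ lam q.1}) (LinearMap.toSpanSingleton F[X] _ (b q)) (by
        rw [Ideal.span, Submodule.span_singleton_le_iff_mem, LinearMap.mem_ker,
          LinearMap.toSpanSingleton_apply, hb, hι, map_zero, map_zero]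
        rw [map_pow, hgh, mul_pow, mul_assoc]
        exact dvd_mul_right _ _)
  have hT (q : Fin l × Fin s) (p : F[X]) : p • b q ∈ LinearMap.range T := by
    have h : T (lof F[X] _ (fun q : Fin l × Fin s => F[X] ⧸ Ideal.span {g ^ lam q.1}) q
        (Submodule.mkQ (Ideal.span {g ^ lam q.1}) p)) = p • b q := by
      rw [toModule_lof, Submodule.mkQ_apply, Submodule.liftQ_apply,
        LinearMap.toSpanSingleton_apply]
    exact h ▸ LinearMap.mem_range_self T _
  have hsurj : Function.Surjective T := by
    intro y
    obtain ⟨z, rfl⟩ := (e.symm.toEquiv.trans c.toEquiv).surjective y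
    change c (e.symm z) ∈ LinearMap.range T
    induction z using DirectSum.induction_on with
    | zero => simp
    | add x y hx hy => rw [map_add, map_add]; exact add_mem hx hy
    | of i x =>
      obtain ⟨v, rfl⟩ := Submodule.mkQ_surjective _ x
      obtain ⟨p, hp⟩ := hB (lam i) v
      have := hι i _ hp
      rw [map_sub, sub_eq_zero] at this
      change c (e.symm (ι i v)) ∈ _
      rw [this, map_sum, map_sum, map_sum]
      refine sum_mem fun j _ => ?_
      rw [← hb (i, j)]
      exact hT _ _
  have hfin {r : F[X]} (hr : r ≠ 0) : FiniteDimensional F (F[X] ⧸ Ideal.span {r}) :=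
    (AdjoinRoot.powerBasis hr).finite
  have hfinf (i : Fin l) := hfin (pow_ne_zero (lam i) hf)
  have hfing (q : Fin l × Fin s) := hfin (pow_ne_zero (lam q.1) hg)
  have hrank : Module.finrank F (⨁ q : Fin l × Fin s, F[X] ⧸ Ideal.span {g ^ lam q.1}) =
      Module.finrank F (Module.AEval' (φ ^ M)) := by
    rw [← c.finrank_eq, (e.restrictScalars F).finrank_eq, Module.finrank_directSum,
      Module.finrank_directSum]
    simp only [finrank_quotient_span_eq_natDegree, natDegree_pow, Fintype.sum_prod_type,
      Finset.sum_const, Finset.card_univ, Fintype.card_fin, smul_eq_mul, hdeg]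
    exact Finset.sum_congr rfl fun i _ => by ring
  have : FiniteDimensional F (Module.AEval' (φ ^ M)) :=
    Module.Finite.equiv (Module.AEval'.of (φ ^ M))
  have hinj := injective_of_surjective_of_finrank_eq hrank hsurj
  exact ⟨(LinearEquiv.ofBijective T ⟨hinj, hsurj⟩).symm⟩

/-- Let `gcd(q,M) = 1` and `α ∈ GL(n, F_q)` with `F_q^n`, as an
`F_q[X]`-module via `α`, isomorphic to `⊕_{i=1}^l F_q[X]/(f^{λ_i})` for a single monic
irreducible `f ≠ X` of degree `k` and `λ_1 ≥ … ≥ λ_l ≥ 1`.  Let `f_M` be the minimal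
polynomial of the `M`-th power of a root of `f`, of degree `d`, and `s = k/d`.  Then
`F_q^n`, as an `F_q[X]`-module via `α^M`, is isomorphic to
`⊕_{i=1}^l (F_q[X]/(f_M^{λ_i}))^{⊕ s}`. -/
theorem statement6 (F : Type*) [Field F] [Fintype F] (M : ℕ) (hM : 2 ≤ M)
    (hcop : Nat.Coprime (Fintype.card F) M)
    (n : ℕ) (α : GL (Fin n) F)
    (f : F[X]) (hmon : f.Monic) (hirr : Irreducible f) (hfX : f ≠ X)
    (k : ℕ) (hk : f.natDegree = k)
    (l : ℕ) (hl : 0 < l) (lam : Fin l → ℕ)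
    (hanti : ∀ i j : Fin l, i ≤ j → lam j ≤ lam i) (hpos : ∀ i, 1 ≤ lam i)
    (hn : n = k * ∑ i, lam i)
    (hiso : Nonempty ((Module.AEval' (Matrix.mulVecLin (α : Matrix (Fin n) (Fin n) F)))
      ≃ₗ[F[X]] ⨁ i : Fin l, F[X] ⧸ Ideal.span {f ^ lam i}))
    (E : Type*) [Field E] [Algebra F E] (η : E) (hη : Polynomial.aeval η f = 0)
    (fM : F[X]) (hfM : fM = minpoly F (η ^ M))
    (d : ℕ) (hd : fM.natDegree = d) (s : ℕ) (hs : s = k / d) :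
    Nonempty ((Module.AEval'
        (Matrix.mulVecLin ((α ^ M : GL (Fin n) F) : Matrix (Fin n) (Fin n) F)))
      ≃ₗ[F[X]] ⨁ p : Fin l × Fin s, F[X] ⧸ Ideal.span {fM ^ lam p.1}) := by
  have hfmin : f = minpoly F η := minpoly.eq_of_irreducible_of_monic hirr hη hmon
  have hint : IsIntegral F η := ⟨f, hmon, hη⟩
  obtain ⟨s', hdeg, B, hB⟩ := exists_generators_mod hint M
  rw [← hfmin, ← hfM] at hdeg
  simp only [← hfmin] at hB
  have hintM : IsIntegral F (η ^ M) := hint.pow M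
  have hgirr : Irreducible fM := hfM ▸ minpoly.irreducible hintM
  have hgmon : fM.Monic := hfM ▸ minpoly.monic hintM
  obtain rfl : s = s' := by
    rw [hs, ← hk, ← hd, hdeg, Nat.mul_div_cancel_left _ hgirr.natDegree_pos]
  have hη0 : η ≠ 0 := by
    rintro rfl
    exact hfX (by rw [hfmin, minpoly.zero])
  have hXg : ¬ X ∣ fM := by
    rw [X_dvd_iff, hfM, minpoly.coeff_zero_eq_zero hintM]
    exact pow_ne_zero M hη0
  have hMF : (M : F) ≠ 0 := by
    obtain ⟨p, hp⟩ := CharP.exists F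
    obtain ⟨r, hpp, hr⟩ := FiniteField.card F p
    rw [Ne, CharP.cast_eq_zero_iff F p]
    intro hpM
    rw [hr] at hcop
    exact hpp.one_lt.ne' (Nat.Coprime.eq_one_of_dvd (hcop.coprime_dvd_left
      (dvd_pow_self p r.pos.ne')) hpM)
  have hsep := separable_expand (PerfectField.separable_of_irreducible hgirr) hXg hMF
  obtain ⟨h, hgh⟩ : f ∣ expand F M fM := by
    rw [hfmin]
    refine minpoly.dvd F η ?_
    rw [expand_aeval, hfM, minpoly.aeval]
  have hfh : IsCoprime f h := (hgh ▸ hsep).isCoprime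
  obtain ⟨e⟩ := hiso
  have hpow : Matrix.mulVecLin ((α ^ M : GL (Fin n) F) : Matrix (Fin n) (Fin n) F) =
      (Matrix.mulVecLin (α : Matrix (Fin n) (Fin n) F)) ^ M := by
    rw [Units.val_pow_eq_pow_val]
    exact Matrix.toLin'_pow _ _
  rw [hpow]
  exact nonempty_aeval_pow_equiv _ lam hmon.ne_zero hgmon.ne_zero hdeg hgh e
    (exists_generators_mod_pow hgh hfh hB)
end

section
/- Let M ≥ 2 with gcd(q, M) = 1 and let α ∈ GL(n, F_q). Suppose that F_q^n, viewed as an F_q[X]-module with X acting as α, is isomorphic to ⊕_{i=1}^{l} ⊕_{j ∈ S_i} F_q[X]/(f_i^{j}), where f_1,…,f_l are distinct monic irreducible polynomials ≠ X and each S_i is a finite nonempty set of distinct positive integers (i.e., for each f_i every elementary divisor exponent occurs at most once). Then the equation X^M = α has a solution in GL(n, F_q) if and only if every f_i is an M-power polynomial. -/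
open Polynomial DirectSum

/-- An irreducible `f` is an `M`-power polynomial iff `X` is an `M`-th power modulo `f`. -/
theorem exists_irreducible_dvd_comp_X_pow_iff {F : Type*} [Field F] {M : ℕ} {f : F[X]}
    (hf : Irreducible f) :
    (∃ g : F[X], Irreducible g ∧ g ∣ f.comp (X ^ M) ∧ g.natDegree = f.natDegree) ↔
      ∃ r : F[X], f ∣ r ^ M - X := by
  have : Fact (Irreducible f) := ⟨hf⟩
  have hfin : FiniteDimensional F (AdjoinRoot f) := (AdjoinRoot.powerBasis hf.ne_zero).finite
  constructor
  · rintro ⟨g, hg, hdvd, hdeg⟩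
    have : Fact (Irreducible g) := ⟨hg⟩
    have hfin' : FiniteDimensional F (AdjoinRoot g) := (AdjoinRoot.powerBasis hg.ne_zero).finite
    have h0 : aeval (AdjoinRoot.root g ^ M) f = 0 := by
      have h1 : aeval (AdjoinRoot.root g) (f.comp (X ^ M)) = 0 := by
        rw [AdjoinRoot.aeval_eq]
        exact AdjoinRoot.mk_eq_zero.mpr hdvd
      simpa [aeval_comp] using h1
    let φ : AdjoinRoot f →ₐ[F] AdjoinRoot g :=
      AdjoinRoot.liftAlgHom f (Algebra.ofId F _) (AdjoinRoot.root g ^ M) h0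
    have hφ : φ (AdjoinRoot.root f) = AdjoinRoot.root g ^ M := AdjoinRoot.liftAlgHom_root ..
    have hinj : Function.Injective φ := φ.toRingHom.injective
    have hsurj : Function.Surjective φ := by
      refine (LinearMap.injective_iff_surjective_of_finrank_eq_finrank
        (f := φ.toLinearMap) ?_).mp hinj
      rw [(AdjoinRoot.powerBasis hf.ne_zero).finrank, (AdjoinRoot.powerBasis hg.ne_zero).finrank]
      simp [hdeg]
    obtain ⟨y, hy⟩ := hsurj (AdjoinRoot.root g)
    obtain ⟨r, rfl⟩ := AdjoinRoot.mk_surjective y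
    refine ⟨r, AdjoinRoot.mk_eq_mk.mp (hinj ?_)⟩
    rw [map_pow, map_pow, hy, AdjoinRoot.mk_X, hφ]
  · rintro ⟨r, hr⟩
    set y := AdjoinRoot.mk f r with hy
    have hyM : y ^ M = AdjoinRoot.root f := by
      rw [hy, ← map_pow, ← AdjoinRoot.mk_X]
      exact AdjoinRoot.mk_eq_mk.mpr hr
    have hint : IsIntegral F y := Algebra.IsIntegral.isIntegral y
    refine ⟨minpoly F y, minpoly.irreducible hint, minpoly.dvd _ _ ?_, ?_⟩
    · simp [aeval_comp, hyM]
    · have htop : IntermediateField.adjoin F {y} = ⊤ := by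
        refine IntermediateField.toSubalgebra_injective (top_le_iff.mp ?_)
        rw [← AdjoinRoot.adjoinRoot_eq_top (f := f)]
        refine Algebra.adjoin_le (Set.singleton_subset_iff.mpr ?_)
        rw [← hyM]
        exact pow_mem (IntermediateField.mem_adjoin_simple_self F y) M
      rw [← IntermediateField.adjoin.finrank hint, htop, IntermediateField.finrank_top',
        (AdjoinRoot.powerBasis hf.ne_zero).finrank]
      simp

/-- An `M`-th root of `X` modulo an irreducible `f ≠ X` lifts to one modulo `f ^ k`. -/
theorem exists_pow_eq_mk_X {F : Type*} [Field F] {M : ℕ} (hM : (M : F) ≠ 0) {f r : F[X]}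
    (hfX : IsCoprime f X) (hr : f ∣ r ^ M - X) (k : ℕ) :
    ∃ c : F[X] ⧸ Ideal.span {f ^ k}, c ^ M = Ideal.Quotient.mk _ X := by
  set π := Ideal.Quotient.mk (Ideal.span {f ^ k}) with hπ
  have hM0 : M ≠ 0 := by rintro rfl; simp at hM
  have hnil : ∀ p : F[X], f ∣ p → IsNilpotent (π p) := fun p hp =>
    ⟨k, by rw [← map_pow, hπ, Ideal.Quotient.eq_zero_iff_mem, Ideal.mem_span_singleton]
           exact pow_dvd_pow_of_dvd hp k⟩
  have hXunit : IsUnit (π X) := by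
    obtain ⟨a, b, hab⟩ := hfX.pow_left (m := k)
    refine IsUnit.of_mul_eq_one (π b) ?_
    rw [← map_mul, ← map_one π]
    refine Ideal.Quotient.eq.mpr (Ideal.mem_span_singleton.mpr ⟨-a, ?_⟩)
    linear_combination hab
  have hrunit : IsUnit (π r) := by
    have h : IsUnit (π (r ^ M)) := by
      have := (hnil _ hr).isUnit_add_left_of_commute hXunit (Commute.all _ _)
      rwa [← map_add, add_sub_cancel] at this
    rw [map_pow] at h
    exact (isUnit_pow_iff hM0).mp h
  obtain ⟨c, ⟨-, hc⟩, -⟩ := existsUnique_nilpotent_sub_and_aeval_eq_zero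
    (R := F[X]) (P := X ^ M - C X) (x := π r)
    (by
      have : aeval (π r) (X ^ M - C X : F[X][X]) = π (r ^ M - X) := by
        simp [hπ, Ideal.Quotient.algebraMap_eq]
      rw [this]
      exact hnil _ hr)
    (by
      have : IsUnit ((M : F[X] ⧸ Ideal.span {f ^ k})) := by
        have := (IsUnit.mk0 _ hM).map (π.comp C)
        simpa using this
      simpa [derivative_X_pow] using this.mul (hrunit.pow (M - 1)))
  refine ⟨c, ?_⟩
  simpa [sub_eq_zero, Ideal.Quotient.algebraMap_eq] using hc

/-- If an endomorphism `φ` acts on `v` as the scalar `r` modulo `a N`, then `φ ^ m` acts as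
`r ^ m` modulo `a N`. -/
theorem Module.End.exists_pow_apply_eq_add_smul {R N : Type*} [CommRing R] [AddCommGroup N]
    [Module R N] (φ : Module.End R N) {a r : R} {v u : N} (h : φ v = r • v + a • u) (m : ℕ) :
    ∃ w, (φ ^ m) v = r ^ m • v + a • w := by
  induction m with
  | zero => exact ⟨0, by simp⟩
  | succ m ih =>
    obtain ⟨w, hw⟩ := ih
    refine ⟨r ^ m • u + φ w, ?_⟩
    rw [pow_succ', Module.End.mul_apply, hw, map_add, map_smul, map_smul, h]
    module

/-- For pairwise coprime primes `f i`, let `v` be the generator of the socle of the summand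
`R ⧸ (f i ^ j)` of `∏ i, ∏ j ∈ S i, R ⧸ (f i ^ j)`. Every `f i`-torsion element divisible by
`f i ^ (j - 1)` is a multiple of `v` up to elements divisible by `f i ^ j`. -/
theorem exists_eq_smul_single_add_smul {R ι : Type*} [CommRing R] [IsDomain R] [DecidableEq ι]
    {f : ι → R} (hf : ∀ i, f i ≠ 0) (hcop : Pairwise fun i i' => IsCoprime (f i) (f i'))
    {S : ι → Finset ℕ} (hS : ∀ i, 0 ∉ S i) (i : ι) (j : S i)
    (u : ∀ i, ∀ j : S i, R ⧸ Ideal.span {f i ^ (j : ℕ)}) (hu : f i ^ (j : ℕ) • u = 0) :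
    ∃ (r : R) (w : ∀ i, ∀ j : S i, R ⧸ Ideal.span {f i ^ (j : ℕ)}),
      f i ^ ((j : ℕ) - 1) • u =
        r • f i ^ ((j : ℕ) - 1) • (Pi.single i (Pi.single j 1) :
          ∀ i, ∀ j : S i, R ⧸ Ideal.span {f i ^ (j : ℕ)}) + f i ^ (j : ℕ) • w := by
  have hj : 1 ≤ (j : ℕ) := Nat.one_le_iff_ne_zero.mpr fun h => hS i (h ▸ j.2)
  obtain ⟨r, hr⟩ := Ideal.Quotient.mk_surjective (u i j)
  have key : ∀ i' (k : S i'), ∃ w : R ⧸ Ideal.span {f i' ^ (k : ℕ)},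
      f i ^ ((j : ℕ) - 1) • u i' k =
        r • f i ^ ((j : ℕ) - 1) • (Pi.single i (Pi.single j 1) :
          ∀ i, ∀ j : S i, R ⧸ Ideal.span {f i ^ (j : ℕ)}) i' k + f i ^ (j : ℕ) • w := by
    intro i' k
    have huk : f i ^ (j : ℕ) • u i' k = 0 := congrFun (congrFun hu i') k
    obtain ⟨s, hs⟩ := Ideal.Quotient.mk_surjective (u i' k)
    rw [← hs, ← Ideal.Quotient.mk_eq_mk, ← Submodule.Quotient.mk_smul,
      Submodule.Quotient.mk_eq_zero, Ideal.mem_span_singleton, smul_eq_mul] at huk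
    rcases eq_or_ne i' i with rfl | hi
    · rcases eq_or_ne k j with rfl | hk
      · refine ⟨0, ?_⟩
        rw [Pi.single_eq_same, Pi.single_eq_same, ← hr, smul_zero, add_zero, smul_comm]
        congr 1
        rw [Algebra.smul_def, mul_one]; rfl
      · have hkj : (k : ℕ) ≠ j := fun h => hk (Subtype.ext h)
        rw [Pi.single_eq_same, Pi.single_eq_of_ne hk, smul_zero, smul_zero]
        rcases lt_or_gt_of_ne hkj with hlt | hgt
        · refine ⟨0, ?_⟩
          rw [← hs, ← Ideal.Quotient.mk_eq_mk, ← Submodule.Quotient.mk_smul, smul_zero,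
            zero_add, Submodule.Quotient.mk_eq_zero, Ideal.mem_span_singleton, smul_eq_mul]
          exact (pow_dvd_pow _ (by omega)).mul_right _
        · obtain ⟨t, ht⟩ : f i' ^ ((k : ℕ) - j) ∣ s := by
            rw [← Nat.add_sub_of_le hgt.le, pow_add] at huk
            exact (mul_dvd_mul_iff_left (pow_ne_zero _ (hf i'))).mp huk
          refine ⟨Submodule.Quotient.mk (f i' ^ ((k : ℕ) - j - 1) * t), ?_⟩
          rw [← hs, ← Ideal.Quotient.mk_eq_mk, ← Submodule.Quotient.mk_smul,
            ← Submodule.Quotient.mk_smul, zero_add, ht, smul_eq_mul, smul_eq_mul,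
            ← mul_assoc, ← mul_assoc, ← pow_add, ← pow_add]
          congr 3
          omega
    · refine ⟨0, ?_⟩
      have h0 : u i' k = 0 := by
        rw [← hs, Ideal.Quotient.eq_zero_iff_mem, Ideal.mem_span_singleton]
        exact (hcop hi).pow.dvd_of_dvd_mul_left huk
      rw [Pi.single_eq_of_ne hi, h0]
      simp
  choose w hw using key
  exact ⟨r, w, funext fun i' => funext fun k => hw i' k⟩

/-- If `x` acts on `∏ i, ∏ j ∈ S i, R ⧸ (f i ^ j)` as the `M`-th power of an endomorphism, then
`x` is an `M`-th power modulo each `f i` with `S i` nonempty. -/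
theorem exists_dvd_pow_sub_of_end_pow_eq {R ι : Type*} [CommRing R] [IsDomain R]
    {f : ι → R} (hf : ∀ i, f i ≠ 0) (hcop : Pairwise fun i i' => IsCoprime (f i) (f i'))
    {S : ι → Finset ℕ} (hS : ∀ i, 0 ∉ S i) {x : R} {M : ℕ}
    (φ : Module.End R (∀ i, ∀ j : S i, R ⧸ Ideal.span {f i ^ (j : ℕ)}))
    (hφ : ∀ v, (φ ^ M) v = x • v) (i : ι) (hi : (S i).Nonempty) :
    ∃ r : R, f i ∣ r ^ M - x := by
  classical
  obtain ⟨j', hj'⟩ := hi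
  let j : S i := ⟨j', hj'⟩
  have hj : 1 ≤ (j : ℕ) := Nat.one_le_iff_ne_zero.mpr fun h => hS i (h ▸ j.2)
  let e : ∀ i, ∀ j : S i, R ⧸ Ideal.span {f i ^ (j : ℕ)} := Pi.single i (Pi.single j 1)
  have hzero : ∀ y : R ⧸ Ideal.span {f i ^ (j : ℕ)}, f i ^ (j : ℕ) • y = 0 := by
    intro y
    obtain ⟨s, rfl⟩ := Ideal.Quotient.mk_surjective y
    rw [← Ideal.Quotient.mk_eq_mk, ← Submodule.Quotient.mk_smul,
      Submodule.Quotient.mk_eq_zero, Ideal.mem_span_singleton, smul_eq_mul]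
    exact dvd_mul_right _ _
  have he : f i ^ (j : ℕ) • e = 0 := by
    simp only [e]
    rw [← Pi.single_smul, ← Pi.single_smul, hzero, Pi.single_zero, Pi.single_zero]
  obtain ⟨r, u, hu⟩ := exists_eq_smul_single_add_smul hf hcop hS i j (φ e)
    (by rw [← map_smul, he, map_zero])
  rw [← map_smul] at hu
  obtain ⟨w, hw⟩ := φ.exists_pow_apply_eq_add_smul hu M
  refine ⟨r, ?_⟩
  have hij := congrFun (congrFun (hw.symm.trans (hφ _)) i) j
  simp only [Pi.add_apply, Pi.smul_apply, hzero, add_zero] at hij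
  have heij : e i j = 1 := by simp [e]
  rw [heij, ← sub_eq_zero, ← sub_smul, smul_smul, Algebra.smul_def, mul_one,
    Ideal.Quotient.algebraMap_eq, Ideal.Quotient.eq_zero_iff_mem, Ideal.mem_span_singleton] at hij
  have hsplit : f i ^ (j : ℕ) = f i * f i ^ ((j : ℕ) - 1) := by
    rw [← pow_succ', Nat.sub_add_cancel hj]
  rw [hsplit] at hij
  exact (mul_dvd_mul_iff_right (pow_ne_zero _ (hf i))).mp hij

/-- An endomorphism `a` of a vector space is an `M`-th power iff `X` acts on `AEval' a` as the
`M`-th power of an `F[X]`-linear endomorphism. -/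
theorem Module.AEval'.exists_pow_eq_iff {F V : Type*} [Field F] [AddCommGroup V] [Module F V]
    {M : ℕ} {a : Module.End F V} :
    (∃ b : Module.End F V, b ^ M = a) ↔
      ∃ φ : Module.End F[X] (Module.AEval' a), ∀ v, (φ ^ M) v = (X : F[X]) • v := by
  constructor
  · rintro ⟨b, hb⟩
    let φ : Module.End F[X] (Module.AEval' a) :=
      LinearMap.ofAEval a ((Module.AEval'.of a).toLinearMap ∘ₗ b) fun m => by
        have : Commute a b := hb ▸ Commute.pow_self b M
        simpa [Module.AEval'.X_smul_of] using (LinearMap.congr_fun this.eq m).symm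
    have hφ : ∀ m, φ (Module.AEval'.of a m) = Module.AEval'.of a (b m) := fun m => by
      simp [φ, LinearMap.ofAEval]
    have hpow : ∀ k m, (φ ^ k) (Module.AEval'.of a m) = Module.AEval'.of a ((b ^ k) m) := by
      intro k
      induction k with
      | zero => simp
      | succ k ih => intro m; rw [pow_succ, pow_succ, Module.End.mul_apply, hφ, ih]; rfl
    refine ⟨φ, fun v => ?_⟩
    obtain ⟨m, rfl⟩ := (Module.AEval'.of a).surjective v
    rw [hpow, hb, Module.AEval'.X_smul_of]
  · rintro ⟨φ, hφ⟩
    refine ⟨(Module.AEval'.of a).symm.conj (φ.restrictScalars F), ?_⟩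
    have hpow : ∀ k m, (((Module.AEval'.of a).symm.conj (φ.restrictScalars F)) ^ k) m =
        (Module.AEval'.of a).symm ((φ ^ k) (Module.AEval'.of a m)) := by
      intro k
      induction k with
      | zero => simp
      | succ k ih =>
        intro m
        rw [pow_succ, pow_succ, Module.End.mul_apply, ih]
        simp [LinearEquiv.conj_apply]
    ext1 m
    rw [hpow, hφ, Module.AEval'.X_smul_of, LinearEquiv.symm_apply_apply]

theorem Matrix.GeneralLinearGroup.exists_pow_eq_iff {F : Type*} [Field F] {M n : ℕ} (hM : M ≠ 0)
    (α : GL (Fin n) F) :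
    (∃ β : GL (Fin n) F, β ^ M = α) ↔
      ∃ b : Module.End F (Fin n → F),
        b ^ M = Matrix.mulVecLin (α : Matrix (Fin n) (Fin n) F) := by
  constructor
  · rintro ⟨β, rfl⟩
    refine ⟨Matrix.toLin' (β : Matrix (Fin n) (Fin n) F), ?_⟩
    rw [← Matrix.toLin'_pow, Units.val_pow_eq_pow_val, ← Matrix.toLin'_apply']
  · rintro ⟨b, hb⟩
    have h : LinearMap.toMatrix' b ^ M = (α : Matrix (Fin n) (Fin n) F) := by
      refine Matrix.toLin'.injective ?_
      rw [Matrix.toLin'_pow, Matrix.toLin'_toMatrix', hb, Matrix.toLin'_apply']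
    have hu : IsUnit (LinearMap.toMatrix' b) := (isUnit_pow_iff hM).mp (h ▸ α.isUnit)
    exact ⟨hu.unit, Units.ext (by simpa using h)⟩

/-- Let `gcd(q,M) = 1` and `α ∈ GL(n, F_q)` with `F_q^n`, as an
`F_q[X]`-module via `α`, isomorphic to `⊕_i ⊕_{j ∈ S_i} F_q[X]/(f_i^j)` where the `f_i` are
distinct monic irreducible polynomials `≠ X` and each `S_i` is a finite nonempty set of
distinct positive integers.  Then `X^M = α` has a solution in `GL(n, F_q)` iff every `f_i`
is an M-power polynomial. -/
theorem statement7 (F : Type*) [Field F] [Fintype F] (M : ℕ) (hM : 2 ≤ M)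
    (hcop : Nat.Coprime (Fintype.card F) M)
    (n : ℕ) (α : GL (Fin n) F)
    (l : ℕ) (hl : 0 < l) (f : Fin l → F[X]) (hinj : Function.Injective f)
    (hf : ∀ i, (f i).Monic ∧ Irreducible (f i) ∧ f i ≠ X)
    (S : Fin l → Finset ℕ) (hS : ∀ i, (S i).Nonempty) (hS0 : ∀ i, 0 ∉ S i)
    (hiso : Nonempty ((Module.AEval' (Matrix.mulVecLin (α : Matrix (Fin n) (Fin n) F)))
      ≃ₗ[F[X]] ⨁ i : Fin l, ⨁ j : (S i : Finset ℕ), F[X] ⧸ Ideal.span {f i ^ (j : ℕ)})) :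
    (∃ β : GL (Fin n) F, β ^ M = α) ↔
      ∀ i, ∃ g : F[X], Irreducible g ∧ g ∣ (f i).comp (X ^ M) ∧
        g.natDegree = (f i).natDegree := by
  have hcoprime : ∀ p q : F[X], p.Monic → q.Monic → Irreducible p → Irreducible q → p ≠ q →
      IsCoprime p q := fun p q hp hq hp' hq' hne =>
    (hp'.coprime_iff_not_dvd).mpr fun h =>
      hne (eq_of_monic_of_associated hp hq (hp'.associated_of_dvd hq' h))
  have hMF : (M : F) ≠ 0 := by
    obtain ⟨p, hp⟩ := CharP.exists F
    have hpp : p.Prime := CharP.char_is_prime F p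
    rw [Ne, CharP.cast_eq_zero_iff F p]
    intro h
    have hq : p ∣ Fintype.card F := by
      rw [← CharP.cast_eq_zero_iff F p, FiniteField.cast_card_eq_zero]
    exact hpp.one_lt.ne' (Nat.eq_one_of_dvd_coprimes hcop hq h)
  obtain ⟨E₀⟩ := hiso
  let E := E₀ ≪≫ₗ DirectSum.linearEquivFunOnFintype F[X] (Fin l) _ ≪≫ₗ
    LinearEquiv.piCongrRight fun i => DirectSum.linearEquivFunOnFintype F[X] (S i)
      fun j => F[X] ⧸ Ideal.span {f i ^ (j : ℕ)}
  rw [Matrix.GeneralLinearGroup.exists_pow_eq_iff (by omega), Module.AEval'.exists_pow_eq_iff]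
  simp only [fun i => exists_irreducible_dvd_comp_X_pow_iff (M := M) (hf i).2.1]
  constructor
  · rintro ⟨φ, hφ⟩ i
    refine exists_dvd_pow_sub_of_end_pow_eq (fun i => (hf i).2.1.ne_zero)
      (fun i i' h => hcoprime _ _ (hf i).1 (hf i').1 (hf i).2.1 (hf i').2.1 (hinj.ne h)) hS0
      (E.conjRingEquiv φ) (fun v => ?_) i (hS i)
    rw [← map_pow, LinearEquiv.conjRingEquiv_apply_apply, hφ, map_smul, E.apply_symm_apply]
  · intro h
    choose r hr using h
    choose c hc using fun i (j : S i) => exists_pow_eq_mk_X hMF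
      (hcoprime _ _ (hf i).1 monic_X (hf i).2.1 irreducible_X (hf i).2.2) (hr i) (j : ℕ)
    refine ⟨E.symm.conjRingEquiv (Algebra.lmul F[X] _ c), fun v => ?_⟩
    have hcM : c ^ M = algebraMap F[X] _ X := funext fun i => funext fun j => hc i j
    rw [← map_pow, ← map_pow, hcM, LinearEquiv.conjRingEquiv_apply_apply]
    simp
end

section
/- Let M = r^a with r prime, gcd(q, M) = 1, and let α ∈ GL(n, F_q) be semisimple, i.e., its minimal polynomial is squarefree. Write the characteristic polynomial of α as ∏_{i=1}^{l} f_i^{e_i} with f_1,…,f_l distinct monic irreducible polynomials (all ≠ X) and e_i ≥ 1. Then X^M = α has a solution in GL(n, F_q) if and only if for each i one of the following holds: (1) f_i is an M-power polynomial; or (2) f_i ∈ Φ_{M,b} for some 1 ≤ b ≤ a and r^b divides e_i. -/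
open Polynomial

open IntermediateField in
theorem natDegree_minpoly_eq_of_orderOf_eq {F Ω : Type*} [Field F] [Field Ω] [Algebra F Ω]
    [Algebra.IsAlgebraic F Ω] {x y : Ω} (hx : 0 < orderOf x) (h : orderOf x = orderOf y) :
    (minpoly F x).natDegree = (minpoly F y).natDegree := by
  have key : ∀ {x y : Ω}, 0 < orderOf x → orderOf x = orderOf y → F⟮y⟯ ≤ F⟮x⟯ := by
    intro x y hx h
    have : NeZero (orderOf x) := ⟨hx.ne'⟩
    obtain ⟨i, -, rfl⟩ := (IsPrimitiveRoot.orderOf x).eq_pow_of_pow_eq_one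
      (ξ := y) (h ▸ pow_orderOf_eq_one y)
    exact adjoin_simple_le_iff.2 (pow_mem (mem_adjoin_simple_self F x) i)
  rw [← adjoin.finrank (Algebra.IsIntegral.isIntegral x),
    ← adjoin.finrank (Algebra.IsIntegral.isIntegral y),
    le_antisymm (key (h ▸ hx) h.symm) (key hx h)]

theorem orderOf_eq_of_minpoly_eq {F Ω : Type*} [Field F] [Field Ω] [Algebra F Ω]
    {x y : Ω} (h : minpoly F x = minpoly F y) : orderOf x = orderOf y := by
  refine orderOf_eq_orderOf_iff.2 fun k => ?_
  have key : ∀ z : Ω, z ^ k = 1 ↔ minpoly F z ∣ X ^ k - 1 := fun z => by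
    rw [minpoly.dvd_iff]; simp [sub_eq_zero]
  rw [key, key, h]

open IntermediateField in
theorem orderOf_pos_of_isAlgebraic {F Ω : Type*} [Field F] [Finite F] [Field Ω] [Algebra F Ω]
    [Algebra.IsAlgebraic F Ω] {x : Ω} (hx : x ≠ 0) : 0 < orderOf x := by
  have := adjoin.finiteDimensional (Algebra.IsIntegral.isIntegral (R := F) x)
  have : Finite F⟮x⟯ := Module.finite_of_finite F
  have hg : AdjoinSimple.gen F x ≠ 0 := fun h => hx (by
    simpa using congrArg (algebraMap F⟮x⟯ Ω) h)
  have h1 : IsOfFinOrder (AdjoinSimple.gen F x) :=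
    (Units.coeHom _).isOfFinOrder (isOfFinOrder_of_finite (Units.mk0 _ hg))
  exact ((algebraMap F⟮x⟯ Ω).toMonoidHom.isOfFinOrder h1).orderOf_pos

theorem orderOf_eq_orderOf_pow_mul {G : Type*} [Monoid G] {x : G} {r a : ℕ} (hr : r.Prime)
    (h : r ∣ orderOf (x ^ r ^ a)) :
    orderOf x = orderOf (x ^ r ^ a) * r ^ a := by
  have hM : r ^ a ≠ 0 := pow_ne_zero _ hr.ne_zero
  rw [orderOf_pow' x hM] at h ⊢
  suffices Nat.gcd (orderOf x) (r ^ a) = r ^ a by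
    rw [this] at h ⊢
    exact (Nat.div_mul_cancel (this ▸ Nat.gcd_dvd_left _ _)).symm
  obtain ⟨k, hk, hgk⟩ := (Nat.dvd_prime_pow hr).1 (Nat.gcd_dvd_right (orderOf x) (r ^ a))
  rw [hgk] at h ⊢
  rcases hk.lt_or_eq with hlt | rfl
  · exfalso
    have h1 : r ^ (k + 1) ∣ orderOf x := by
      have hdvd : r ^ k ∣ orderOf x := hgk ▸ Nat.gcd_dvd_left (orderOf x) (r ^ a)
      rw [pow_succ, mul_comm, ← Nat.div_mul_cancel hdvd]
      exact Nat.mul_dvd_mul_right h _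
    have h2 := Nat.dvd_gcd h1 (pow_dvd_pow r (show k + 1 ≤ a from hlt))
    rw [hgk, Nat.pow_dvd_pow_iff_le_right hr.one_lt] at h2
    omega
  · rfl

section PowerPolynomial

open IntermediateField

variable {F : Type*} [Field F] {r a : ℕ} {f : F[X]}

/-- If the minimal polynomial `f` has a root whose multiplicative order is prime to `r`, then
`f(X ^ r ^ a)` has an irreducible factor of the same degree as `f`. -/
theorem exists_irreducible_dvd_comp_of_not_dvd_orderOf {Ω : Type*} [Field Ω] [Algebra F Ω]
    [Algebra.IsAlgebraic F Ω] (hr : r.Prime) {x : Ω} (hfx : f = minpoly F x)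
    (hrx : ¬ r ∣ orderOf x) :
    ∃ g : F[X], Irreducible g ∧ g ∣ f.comp (X ^ r ^ a) ∧ g.natDegree = f.natDegree := by
  obtain ⟨k, hk⟩ := exists_pow_eq_self_of_coprime
    (((Nat.Prime.coprime_iff_not_dvd hr).2 hrx).pow_left a)
  have hk' : (x ^ k) ^ r ^ a = x := by rw [pow_right_comm, hk]
  refine ⟨minpoly F (x ^ k), minpoly.irreducible (Algebra.IsIntegral.isIntegral _),
    minpoly.dvd _ _ ?_, ?_⟩
  · simp [aeval_comp, hk', hfx]
  · rw [hfx, ← adjoin.finrank (Algebra.IsIntegral.isIntegral x),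
      ← adjoin.finrank (Algebra.IsIntegral.isIntegral (x ^ k))]
    have : F⟮x ^ k⟯ = F⟮x⟯ := le_antisymm
      (adjoin_simple_le_iff.2 (pow_mem (mem_adjoin_simple_self F x) _))
      (adjoin_simple_le_iff.2 (by
        have h := pow_mem (mem_adjoin_simple_self F (x ^ k)) (r ^ a)
        rwa [hk'] at h))
    rw [this]

theorem natDegree_dvd_natDegree_of_dvd_comp {M : ℕ} (hf : Irreducible f) {g : F[X]}
    (hg : Irreducible g) (hgf : g ∣ f.comp (X ^ M)) : f.natDegree ∣ g.natDegree := by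
  have := Fact.mk hg
  have hroot : aeval (AdjoinRoot.root g) g = 0 := by simp
  have hx : aeval (AdjoinRoot.root g ^ M) f = 0 := by
    simpa [aeval_comp] using aeval_eq_zero_of_dvd_aeval_eq_zero hgf hroot
  have := (AdjoinRoot.powerBasis hg.ne_zero).finite
  have h1 := minpoly.eq_of_irreducible hf hx
  have h2 := minpoly.eq_of_irreducible hg hroot
  rw [← natDegree_mul_C (p := f) (inv_ne_zero (leadingCoeff_ne_zero.2 hf.ne_zero)), h1,
    ← natDegree_mul_C (p := g) (inv_ne_zero (leadingCoeff_ne_zero.2 hg.ne_zero)), h2,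
    ← adjoin.finrank (Algebra.IsIntegral.isIntegral _),
    ← adjoin.finrank (Algebra.IsIntegral.isIntegral _)]
  exact finrank_dvd_of_le_right
    (adjoin_simple_le_iff.2 (pow_mem (mem_adjoin_simple_self F _) _))

theorem natDegree_eq_of_dvd_comp [Finite F] (hr : r.Prime) (hm : f.Monic) (hf : Irreducible f)
    (hX : f ≠ X)
    (hnp : ¬ ∃ g : F[X], Irreducible g ∧ g ∣ f.comp (X ^ r ^ a) ∧ g.natDegree = f.natDegree)
    {g h : F[X]} (hg : Irreducible g) (hh : Irreducible h)
    (hgf : g ∣ f.comp (X ^ r ^ a)) (hhf : h ∣ f.comp (X ^ r ^ a)) :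
    g.natDegree = h.natDegree := by
  let Ω := AlgebraicClosure F
  have key : ∀ {g : F[X]}, Irreducible g → g ∣ f.comp (X ^ r ^ a) → ∃ x : Ω,
      (minpoly F x).natDegree = g.natDegree ∧ minpoly F (x ^ r ^ a) = f ∧
      orderOf x = orderOf (x ^ r ^ a) * r ^ a ∧ 0 < orderOf x := by
    intro g hg hgf
    obtain ⟨x, hx⟩ := IsAlgClosed.exists_aeval_eq_zero Ω g (degree_pos_of_irreducible hg).ne'
    have hfx : minpoly F (x ^ r ^ a) = f := by
      refine (minpoly.eq_of_irreducible_of_monic hf ?_ hm).symm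
      simpa [aeval_comp] using aeval_eq_zero_of_dvd_aeval_eq_zero hgf hx
    have hx0 : x ≠ 0 := by
      rintro rfl
      rw [zero_pow (pow_ne_zero _ hr.ne_zero), minpoly.zero] at hfx
      exact hX hfx.symm
    have hpos := orderOf_pos_of_isAlgebraic (F := F) hx0
    refine ⟨x, ?_, hfx, orderOf_eq_orderOf_pow_mul hr ?_, hpos⟩
    · rw [← minpoly.eq_of_irreducible hg hx,
        natDegree_mul_C (inv_ne_zero (leadingCoeff_ne_zero.2 hg.ne_zero))]
    · by_contra hnd
      exact hnp (exists_irreducible_dvd_comp_of_not_dvd_orderOf hr hfx.symm hnd)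
  obtain ⟨x, hxg, hxf, hxo, hx⟩ := key hg hgf
  obtain ⟨y, hyh, hyf, hyo, -⟩ := key hh hhf
  rw [← hxg, ← hyh]
  refine natDegree_minpoly_eq_of_orderOf_eq hx ?_
  rw [hxo, hyo, orderOf_eq_of_minpoly_eq (hxf.trans hyf.symm)]

/-- Over a finite field, either `f(X ^ r ^ a)` has an irreducible factor of degree `deg f`, or it
is a product of `r ^ (a - b)` irreducible polynomials of degree `r ^ b * deg f`, some `b ≥ 1`. -/
theorem exists_comp_eq_prod_irreducible [Finite F] (hr : r.Prime) (hm : f.Monic)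
    (hf : Irreducible f) (hX : f ≠ X)
    (hnp : ¬ ∃ g : F[X], Irreducible g ∧ g ∣ f.comp (X ^ r ^ a) ∧ g.natDegree = f.natDegree) :
    ∃ b, 1 ≤ b ∧ b ≤ a ∧ ∃ s : Multiset F[X], Multiset.card s = r ^ (a - b) ∧
      (∀ g ∈ s, g.Monic ∧ Irreducible g ∧ g.natDegree = r ^ b * f.natDegree) ∧
      f.comp (X ^ r ^ a) = s.prod := by
  classical
  have hM : r ^ a ≠ 0 := pow_ne_zero _ hr.ne_zero
  have hmc : (f.comp (X ^ r ^ a)).Monic := hm.comp (monic_X_pow _) (by simpa using hM)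
  have hdeg : (f.comp (X ^ r ^ a)).natDegree = r ^ a * f.natDegree := by
    rw [natDegree_comp, natDegree_X_pow, mul_comm]
  have hd : 0 < f.natDegree := hf.natDegree_pos
  have hprod : f.comp (X ^ r ^ a)
      = (UniqueFactorizationMonoid.normalizedFactors (f.comp (X ^ r ^ a))).prod := by
    rw [UniqueFactorizationMonoid.prod_normalizedFactors_eq hmc.ne_zero, hmc.normalize_eq_self]
  set s := UniqueFactorizationMonoid.normalizedFactors (f.comp (X ^ r ^ a)) with hs
  have hirr : ∀ g ∈ s, Irreducible g := fun g hg =>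
    UniqueFactorizationMonoid.irreducible_of_normalized_factor g hg
  have hdvd : ∀ g ∈ s, g ∣ f.comp (X ^ r ^ a) := fun g hg =>
    UniqueFactorizationMonoid.dvd_of_mem_normalizedFactors hg
  have hmon : ∀ g ∈ s, g.Monic := fun g hg => by
    rw [← UniqueFactorizationMonoid.normalize_normalized_factor g hg]
    exact monic_normalize (hirr g hg).ne_zero
  have hs0 : s ≠ 0 := by
    intro h0
    rw [hprod, h0] at hdeg
    simp [hr.ne_zero, hd.ne'] at hdeg
  obtain ⟨g₀, hg₀⟩ := Multiset.exists_mem_of_ne_zero hs0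
  have hall : ∀ g ∈ s, g.natDegree = g₀.natDegree := fun g hg =>
    natDegree_eq_of_dvd_comp hr hm hf hX hnp (hirr g hg) (hirr _ hg₀) (hdvd g hg) (hdvd _ hg₀)
  have hcard : Multiset.card s * g₀.natDegree = r ^ a * f.natDegree := by
    rw [← hdeg, hprod, natDegree_multiset_prod_of_monic _ hmon, Multiset.map_congr rfl hall]
    simp
  obtain ⟨m, hmg⟩ := natDegree_dvd_natDegree_of_dvd_comp hf (hirr _ hg₀) (hdvd _ hg₀)
  have hcm : Multiset.card s * m = r ^ a := by
    apply Nat.eq_of_mul_eq_mul_right hd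
    rw [← hcard, hmg]; ring
  obtain ⟨b, hb, rfl⟩ := (Nat.dvd_prime_pow hr).1 (Dvd.intro_left _ hcm)
  refine ⟨b, ?_, hb, s, ?_, fun g hg => ⟨hmon g hg, hirr g hg, ?_⟩, hprod⟩
  · rw [Nat.one_le_iff_ne_zero]
    rintro rfl
    exact hnp ⟨g₀, hirr _ hg₀, hdvd _ hg₀, by simpa using hmg⟩
  · rw [← Nat.pow_div hb hr.pos, ← hcm, Nat.mul_div_cancel _ (pow_pos hr.pos _)]
  · rw [hall g hg, hmg, mul_comm]

end PowerPolynomial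

section LinearAlgebra

variable {F V : Type*} [Field F] [AddCommGroup V] [Module F V]

theorem LinearMap.coe_aeval_restrict_apply {T : Module.End F V} {p : Submodule F V}
    (hT : ∀ x ∈ p, T x ∈ p) (h : F[X]) (x : p) :
    (aeval (T.restrict hT) h x : V) = aeval T h x := by
  induction h using Polynomial.induction_on' with
  | add h₁ h₂ ih₁ ih₂ => simp [ih₁, ih₂]
  | monomial n c =>
    rw [aeval_monomial, aeval_monomial, Module.End.pow_restrict n hT]
    simp [Module.algebraMap_end_apply]

theorem LinearMap.apply_mem_ker_aeval (T S : Module.End F V) (hS : Commute S T) (h : F[X]) :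
    ∀ x ∈ LinearMap.ker (aeval T h), S x ∈ LinearMap.ker (aeval T h) := by
  intro x hx
  have hc : Commute S (aeval T h) :=
    Algebra.commute_of_mem_adjoin_singleton_of_commute (aeval_mem_adjoin_singleton F T) hS
  rw [LinearMap.mem_ker] at hx ⊢
  rw [← Module.End.mul_apply, ← hc.eq, Module.End.mul_apply, hx, map_zero]

theorem LinearMap.aeval_restrict_ker_eq_zero (T : Module.End F V) (h : F[X])
    (hT : ∀ x ∈ LinearMap.ker (aeval T h), T x ∈ LinearMap.ker (aeval T h)) :
    aeval (T.restrict hT) h = 0 := by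
  ext x
  rw [LinearMap.coe_aeval_restrict_apply]
  exact x.2

variable [FiniteDimensional F V]

theorem LinearMap.irreducible_dvd_of_dvd_charpoly {T : Module.End F V} {h p : F[X]}
    (hT : aeval T h = 0) (hp : Irreducible p) (hpT : p ∣ T.charpoly) : p ∣ h := by
  obtain ⟨μ, hμ⟩ := IsAlgClosed.exists_aeval_eq_zero (AlgebraicClosure F) p
    (degree_pos_of_irreducible hp).ne'
  have hroot : (T.baseChange (AlgebraicClosure F)).charpoly.IsRoot μ := by
    rw [LinearMap.charpoly_baseChange, IsRoot.def, eval_map_algebraMap]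
    exact aeval_eq_zero_of_dvd_aeval_eq_zero hpT hμ
  rw [← Module.End.hasEigenvalue_iff_isRoot_charpoly] at hroot
  obtain ⟨v, hv⟩ := hroot.exists_hasEigenvector
  have h1 := Module.End.aeval_apply_of_hasEigenvector (p := h.map (algebraMap F _)) hv
  rw [aeval_map_algebraMap, eval_map_algebraMap] at h1
  have h2 : aeval (T.baseChange (AlgebraicClosure F)) h = 0 := by
    have := aeval_algHom_apply (Module.End.baseChangeHom F (AlgebraicClosure F) V) T h
    rw [hT, map_zero] at this
    exact this
  rw [h2, LinearMap.zero_apply, eq_comm, smul_eq_zero, or_iff_left hv.2] at h1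
  rw [← minpoly.dvd_iff, ← minpoly.eq_of_irreducible hp hμ] at h1
  exact (dvd_mul_right _ _).trans h1

theorem Polynomial.dvd_natDegree_of_forall_irreducible {D : ℕ} {p : F[X]} (hp : p ≠ 0)
    (h : ∀ g, Irreducible g → g ∣ p → D ∣ g.natDegree) : D ∣ p.natDegree := by
  induction p using UniqueFactorizationMonoid.induction_on_prime with
  | h₁ => exact absurd rfl hp
  | h₂ x hx => simp [natDegree_eq_zero_of_isUnit hx]
  | h₃ a q ha hq ih =>
    rw [natDegree_mul hq.ne_zero ha]
    exact dvd_add (h q hq.irreducible (dvd_mul_right _ _))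
      (ih ha fun g hg hga => h g hg (hga.mul_left _))

theorem LinearMap.charpoly_eq_mul_of_isCompl {T : Module.End F V} {p q : Submodule F V}
    (hpq : IsCompl p q) (hp : ∀ x ∈ p, T x ∈ p) (hq : ∀ x ∈ q, T x ∈ q) :
    T.charpoly = (T.restrict hp).charpoly * (T.restrict hq).charpoly := by
  rw [← LinearMap.charpoly_prodMap,
    ← LinearEquiv.charpoly_conj (Submodule.prodEquivOfIsCompl p q hpq)]
  congr 1
  ext x
  obtain ⟨y, rfl⟩ := (Submodule.prodEquivOfIsCompl p q hpq).surjective x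
  simp [LinearEquiv.conj_apply]

theorem LinearMap.finrank_ker_aeval {T : Module.End F V} {f p : F[X]} {e : ℕ} (he : e ≠ 0)
    (hf : f.Monic) (hsq : Squarefree (minpoly F T)) (hfp : IsCoprime f p)
    (hT : T.charpoly = f ^ e * p) :
    Module.finrank F (LinearMap.ker (aeval T f)) = e * f.natDegree := by
  have hmin : aeval T (f * p) = 0 := by
    have h1 : minpoly F T ∣ (f * p) ^ e :=
      T.minpoly_dvd_charpoly.trans (by
        rw [hT, mul_pow]
        exact mul_dvd_mul_left _ (dvd_pow_self _ he))
    obtain ⟨c, hc⟩ := (hsq.dvd_pow_iff_dvd he).1 h1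
    rw [hc, map_mul, minpoly.aeval, zero_mul]
  have hcompl : IsCompl (LinearMap.ker (aeval T f)) (LinearMap.ker (aeval T p)) :=
    ⟨disjoint_ker_aeval_of_isCoprime T hfp, codisjoint_iff.2 <| by
      rw [sup_ker_aeval_eq_ker_aeval_mul_of_coprime T hfp, hmin, LinearMap.ker_zero]⟩
  have hTf := LinearMap.apply_mem_ker_aeval T T (Commute.refl T) f
  have hTp := LinearMap.apply_mem_ker_aeval T T (Commute.refl T) p
  have hmul := LinearMap.charpoly_eq_mul_of_isCompl hcompl hTf hTp
  rw [hT] at hmul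
  have h0 := LinearMap.aeval_restrict_ker_eq_zero T f hTf
  have h1 := LinearMap.aeval_restrict_ker_eq_zero T p hTp
  have hmA := (T.restrict hTf).charpoly_monic
  have hmB := (T.restrict hTp).charpoly_monic
  rw [← LinearMap.charpoly_natDegree (T.restrict hTf), ← hf.natDegree_pow]
  have hAp : IsCoprime (T.restrict hTf).charpoly p :=
    isCoprime_of_irreducible_dvd (fun h => hmA.ne_zero h.1) fun g hg hgA hgp =>
      hg.not_isUnit (hfp.isUnit_of_dvd' (LinearMap.irreducible_dvd_of_dvd_charpoly h0 hg hgA) hgp)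
  have hfB : IsCoprime f (T.restrict hTp).charpoly :=
    isCoprime_of_irreducible_dvd (fun h => hmB.ne_zero h.2) fun g hg hgf hgB =>
      hg.not_isUnit (hfp.isUnit_of_dvd' hgf (LinearMap.irreducible_dvd_of_dvd_charpoly h1 hg hgB))
  rw [eq_of_monic_of_associated hmA (hf.pow e) (associated_of_dvd_dvd
    (hAp.dvd_of_dvd_mul_right (hmul ▸ dvd_mul_right _ _))
    ((hfB.pow_left).dvd_of_dvd_mul_right (hmul ▸ dvd_mul_right _ _)))]

theorem LinearMap.dvd_finrank_of_aeval_eq_zero {T : Module.End F V} {h : F[X]} {D : ℕ}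
    (hT : aeval T h = 0) (hD : ∀ g, Irreducible g → g ∣ h → D ∣ g.natDegree) :
    D ∣ Module.finrank F V := by
  rw [← T.charpoly_natDegree]
  exact dvd_natDegree_of_forall_irreducible T.charpoly_monic.ne_zero fun g hg hgT =>
    hD g hg (LinearMap.irreducible_dvd_of_dvd_charpoly hT hg hgT)

theorem LinearMap.dvd_finrank_ker_aeval_pow {S : Module.End F V} {M D : ℕ} {f : F[X]}
    (hD : ∀ g, Irreducible g → g ∣ f.comp (X ^ M) → D ∣ g.natDegree) :
    D ∣ Module.finrank F (LinearMap.ker (aeval (S ^ M) f)) := by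
  have hS := LinearMap.apply_mem_ker_aeval (S ^ M) S ((Commute.refl S).pow_right M) f
  refine LinearMap.dvd_finrank_of_aeval_eq_zero (T := S.restrict hS) (h := f.comp (X ^ M)) ?_ hD
  ext x
  rw [LinearMap.coe_aeval_restrict_apply, aeval_comp]
  simp

end LinearAlgebra

section Roots

theorem DirectSum.IsInternal.exists_pow_eq_smul {R V ι : Type*} [CommRing R] [AddCommGroup V]
    [Module R V] [DecidableEq ι] {W : ι → Submodule R V} (hW : DirectSum.IsInternal W) {M : ℕ}
    (x : R) (h : ∀ i, ∃ φ : W i →ₗ[R] W i, ∀ w, (φ ^ M) w = x • w) :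
    ∃ φ : V →ₗ[R] V, ∀ v, (φ ^ M) v = x • v := by
  choose φ hφ using h
  let e := LinearEquiv.ofBijective (DirectSum.coeLinearMap W) hW
  refine ⟨e.conjRingEquiv (DirectSum.lmap φ), fun v => ?_⟩
  have hpow : ∀ k : ℕ, DirectSum.lmap φ ^ k = DirectSum.lmap fun i => φ i ^ k := by
    intro k
    induction k with
    | zero => exact DirectSum.lmap_id.symm
    | succ k ih =>
      simp only [pow_succ, ih]
      exact (DirectSum.lmap_comp _ _).symm
  have hM : DirectSum.lmap φ ^ M = x • LinearMap.id := by
    rw [hpow]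
    ext i w
    simp [hφ]
  rw [← map_pow, hM]
  simp

theorem LinearMap.exists_pow_eq_smul_of_finrank_dvd {K L W : Type*} [Field K] [Field L]
    [Algebra K L] [FiniteDimensional K L] [AddCommGroup W] [Module K W] [FiniteDimensional K W]
    (h : Module.finrank K L ∣ Module.finrank K W) {M : ℕ} {x : K} {y : L}
    (hy : y ^ M = algebraMap K L x) : ∃ φ : W →ₗ[K] W, ∀ w, (φ ^ M) w = x • w := by
  obtain ⟨k, hk⟩ := h
  have e : (Fin k → L) ≃ₗ[K] W := LinearEquiv.ofFinrankEq _ _ (by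
    rw [hk, Module.finrank_pi_fintype]
    simp [mul_comm])
  refine ⟨e.conjRingEquiv (Algebra.lsmul K K (Fin k → L) y), fun w => ?_⟩
  rw [← map_pow, ← map_pow, hy]
  simp

theorem AdjoinRoot.exists_pow_eq_root_smul {F W : Type*} [Field F] {f g : F[X]}
    [Fact (Irreducible f)] (hg : Irreducible g) {M m : ℕ} (hgf : g ∣ f.comp (X ^ M))
    (hgm : g.natDegree = m * f.natDegree) [AddCommGroup W] [Module F W]
    [Module (AdjoinRoot f) W] [IsScalarTower F (AdjoinRoot f) W] [FiniteDimensional F W]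
    (hW : m * f.natDegree ∣ Module.finrank F W) :
    ∃ φ : W →ₗ[AdjoinRoot f] W, ∀ w, (φ ^ M) w = AdjoinRoot.root f • w := by
  have hf : Irreducible f := Fact.out
  have := Fact.mk hg
  have hx : f.eval₂ (Algebra.ofId F (AdjoinRoot g)) (AdjoinRoot.root g ^ M) = 0 := by
    have : aeval (AdjoinRoot.root g ^ M) f = 0 := by
      simpa [aeval_comp] using
        aeval_eq_zero_of_dvd_aeval_eq_zero (x := AdjoinRoot.root g) hgf
          (by rw [AdjoinRoot.aeval_eq, AdjoinRoot.mk_self])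
    exact this
  let i := AdjoinRoot.liftAlgHom f (Algebra.ofId F (AdjoinRoot g)) (AdjoinRoot.root g ^ M) hx
  let := i.toRingHom.toAlgebra
  have : IsScalarTower F (AdjoinRoot f) (AdjoinRoot g) :=
    IsScalarTower.of_algebraMap_eq' i.comp_algebraMap.symm
  have := (AdjoinRoot.powerBasis hg.ne_zero).finite
  have := (AdjoinRoot.powerBasis hf.ne_zero).finite
  have : FiniteDimensional (AdjoinRoot f) (AdjoinRoot g) :=
    Module.Finite.of_restrictScalars_finite F _ _
  have : FiniteDimensional (AdjoinRoot f) W := Module.Finite.of_restrictScalars_finite F _ _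
  have hfin : Module.finrank F (AdjoinRoot f) = f.natDegree := by
    rw [(AdjoinRoot.powerBasis hf.ne_zero).finrank, AdjoinRoot.powerBasis_dim]
  have hgin : Module.finrank F (AdjoinRoot g) = g.natDegree := by
    rw [(AdjoinRoot.powerBasis hg.ne_zero).finrank, AdjoinRoot.powerBasis_dim]
  have h1 := Module.finrank_mul_finrank F (AdjoinRoot f) (AdjoinRoot g)
  have h2 := Module.finrank_mul_finrank F (AdjoinRoot f) W
  refine LinearMap.exists_pow_eq_smul_of_finrank_dvd (L := AdjoinRoot g)
    (y := AdjoinRoot.root g) ?_ (AdjoinRoot.liftAlgHom_root _ _ _ hx).symm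
  rw [← hgm, ← hgin, ← h1, ← h2] at hW
  exact Nat.dvd_of_mul_dvd_mul_left (hfin ▸ hf.natDegree_pos) hW

theorem Module.AEval'.exists_pow_eq_smul_torsionBy {F V : Type*} [Field F] [AddCommGroup V]
    [Module F V] [FiniteDimensional F V] {T : Module.End F V} {f g : F[X]} (hf : Irreducible f)
    (hg : Irreducible g) {M m : ℕ} (hgf : g ∣ f.comp (X ^ M))
    (hgm : g.natDegree = m * f.natDegree)
    (hW : m * f.natDegree ∣ Module.finrank F (LinearMap.ker (aeval T f))) :
    ∃ φ : Submodule.torsionBy F[X] (Module.AEval' T) f →ₗ[F[X]]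
        Submodule.torsionBy F[X] (Module.AEval' T) f, ∀ w, (φ ^ M) w = (X : F[X]) • w := by
  have := Fact.mk hf
  let _ : Module (AdjoinRoot f) (Submodule.torsionBy F[X] (Module.AEval' T) f) :=
    (inferInstance : Module (F[X] ⧸ Ideal.span {f}) (Submodule.torsionBy F[X] _ f))
  have : IsScalarTower F (AdjoinRoot f) (Submodule.torsionBy F[X] (Module.AEval' T) f) :=
    inferInstanceAs (IsScalarTower F (F[X] ⧸ Ideal.span {f}) _)
  have hmap : (Submodule.torsionBy F[X] (Module.AEval' T) f).restrictScalars F =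
      (LinearMap.ker (aeval T f)).map (Module.AEval'.of T).toLinearMap := by
    ext x
    obtain ⟨v, rfl⟩ := (Module.AEval'.of T).surjective x
    have hfv : f • Module.AEval'.of T v = Module.AEval'.of T (aeval T f v) := rfl
    simp [Submodule.mem_torsionBy_iff, hfv]
  have hfd : FiniteDimensional F (Submodule.torsionBy F[X] (Module.AEval' T) f) :=
    inferInstanceAs (FiniteDimensional F
      ((Submodule.torsionBy F[X] (Module.AEval' T) f).restrictScalars F))
  have hrank : Module.finrank F (Submodule.torsionBy F[X] (Module.AEval' T) f) =
      Module.finrank F (LinearMap.ker (aeval T f)) := by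
    rw [← LinearEquiv.finrank_map_eq (Module.AEval'.of T), ← hmap]
    rfl
  obtain ⟨φ, hφ⟩ := AdjoinRoot.exists_pow_eq_root_smul
    (W := Submodule.torsionBy F[X] (Module.AEval' T) f) hg hgf hgm (hrank ▸ hW)
  let ψ : Submodule.torsionBy F[X] (Module.AEval' T) f →ₗ[F[X]]
      Submodule.torsionBy F[X] (Module.AEval' T) f :=
    { φ with map_smul' := fun p w => φ.map_smul (AdjoinRoot.mk f p) w }
  refine ⟨ψ, fun w => ?_⟩
  rw [Module.End.pow_apply]
  have := hφ w
  rw [Module.End.pow_apply] at this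
  exact this

theorem LinearMap.exists_pow_eq_of_irreducible_dvd_comp {F V : Type*} [Field F] [AddCommGroup V]
    [Module F V] [FiniteDimensional F V] {T : Module.End F V} {ι : Type*} [Fintype ι]
    {f : ι → F[X]} (hf : ∀ i, Irreducible (f i)) (hcop : Pairwise fun i j => IsCoprime (f i) (f j))
    (hT : aeval T (∏ i, f i) = 0) {M : ℕ}
    (h : ∀ i, ∃ (m : ℕ) (g : F[X]), Irreducible g ∧ g ∣ (f i).comp (X ^ M) ∧
      g.natDegree = m * (f i).natDegree ∧
      m * (f i).natDegree ∣ Module.finrank F (LinearMap.ker (aeval T (f i)))) :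
    ∃ S : Module.End F V, S ^ M = T := by
  classical
  have hint : DirectSum.IsInternal fun i : (Finset.univ : Finset ι) =>
      Submodule.torsionBy F[X] (Module.AEval' T) (f i) := by
    refine Submodule.torsionBy_isInternal (fun i _ j _ hij => hcop hij) fun x => ?_
    obtain ⟨v, rfl⟩ := (Module.AEval'.of T).surjective x
    exact (congrArg (Module.AEval'.of T) (LinearMap.congr_fun hT v)).trans (map_zero _)
  obtain ⟨φ, hφ⟩ := hint.exists_pow_eq_smul (M := M) X fun i => by
    obtain ⟨m, g, hg, hgf, hgm, hW⟩ := h i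
    exact Module.AEval'.exists_pow_eq_smul_torsionBy (hf i) hg hgf hgm hW
  refine ⟨(Module.AEval'.of T).symm.conjRingEquiv (φ.restrictScalars F), ?_⟩
  ext v
  rw [← map_pow]
  have h1 : ((φ.restrictScalars F) ^ M) (Module.AEval'.of T v) = Module.AEval'.of T (T v) := by
    rw [← Module.AEval'.X_smul_of, ← hφ, Module.End.pow_apply, Module.End.pow_apply]
    rfl
  rw [LinearEquiv.conjRingEquiv_apply_apply]
  simp [h1]

end Roots

/-- Let `M = r^a` with `r` prime, `gcd(q,M) = 1`, and let
`α ∈ GL(n, F_q)` be semisimple (squarefree minimal polynomial) with characteristic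
polynomial `∏_i f_i^{e_i}`, the `f_i` distinct monic irreducible `≠ X` and `e_i ≥ 1`.
Then `X^M = α` has a solution in `GL(n, F_q)` iff for each `i` either `f_i` is an M-power
polynomial, or `f_i ∈ Φ_{M,b}` for some `1 ≤ b ≤ a` (i.e. `f_i(X^M)` is a product of
`r^{a−b}` irreducible polynomials each of degree `r^b · deg f_i`) and `r^b ∣ e_i`. -/
theorem statement13 (F : Type*) [Field F] [Fintype F] (r a M : ℕ) (hr : r.Prime) (ha : 1 ≤ a)
    (hMra : M = r ^ a) (hcop : Nat.Coprime (Fintype.card F) M)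
    (n : ℕ) (α : GL (Fin n) F)
    (hss : Squarefree (minpoly F (α : Matrix (Fin n) (Fin n) F)))
    (l : ℕ) (hl : 0 < l) (f : Fin l → F[X]) (hinj : Function.Injective f)
    (hf : ∀ i, (f i).Monic ∧ Irreducible (f i) ∧ f i ≠ X)
    (e : Fin l → ℕ) (he : ∀ i, 1 ≤ e i)
    (hch : Matrix.charpoly (α : Matrix (Fin n) (Fin n) F) = ∏ i, f i ^ e i) :
    (∃ β : GL (Fin n) F, β ^ M = α) ↔
      ∀ i, (∃ g : F[X], Irreducible g ∧ g ∣ (f i).comp (X ^ M) ∧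
          g.natDegree = (f i).natDegree) ∨
        ∃ b, 1 ≤ b ∧ b ≤ a ∧
          (∃ s : Multiset F[X], Multiset.card s = r ^ (a - b) ∧
            (∀ g ∈ s, g.Monic ∧ Irreducible g ∧ g.natDegree = r ^ b * (f i).natDegree) ∧
            (f i).comp (X ^ M) = s.prod) ∧
          r ^ b ∣ e i := by
  subst hMra
  set T : Module.End F (Fin n → F) := Matrix.toLin' (α : Matrix (Fin n) (Fin n) F) with hTdef
  have hcop' : Pairwise fun i j => IsCoprime (f i) (f j) := fun i j hij =>
    ((hf i).2.1.isCoprime_or_dvd (f j)).resolve_right fun hd => hij <| hinj <|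
      eq_of_monic_of_associated (hf i).1 (hf j).1 ((hf i).2.1.associated_of_dvd (hf j).2.1 hd)
  have hsq : Squarefree (minpoly F T) := by rwa [hTdef, Matrix.minpoly_toLin']
  have hcharpoly : T.charpoly = ∏ i, f i ^ e i := by rwa [hTdef, Matrix.charpoly_toLin']
  have hrank : ∀ i, Module.finrank F (LinearMap.ker (aeval T (f i))) = e i * (f i).natDegree := by
    intro i
    refine LinearMap.finrank_ker_aeval (p := ∏ j ∈ Finset.univ.erase i, f j ^ e j)
      (Nat.one_le_iff_ne_zero.1 (he i)) (hf i).1 hsq ?_ ?_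
    · exact IsCoprime.prod_right fun j hj =>
        (hcop' (Finset.ne_of_mem_erase hj).symm).pow_right
    · rw [hcharpoly, Finset.mul_prod_erase _ (fun j => f j ^ e j) (Finset.mem_univ i)]
  constructor
  · rintro ⟨β, hβ⟩ i
    refine or_iff_not_imp_left.2 fun hnp => ?_
    obtain ⟨b, hb1, hba, s, hcard, hs, hprod⟩ :=
      exists_comp_eq_prod_irreducible hr (hf i).1 (hf i).2.1 (hf i).2.2 hnp
    refine ⟨b, hb1, hba, ⟨s, hcard, hs, hprod⟩, ?_⟩
    have hT : (Matrix.toLin' (β : Matrix (Fin n) (Fin n) F)) ^ r ^ a = T := by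
      rw [← Matrix.toLin'_pow, hTdef, ← hβ, Units.val_pow_eq_pow_val]
    have hdvd := LinearMap.dvd_finrank_ker_aeval_pow (f := f i) (D := r ^ b * (f i).natDegree)
      (S := Matrix.toLin' (β : Matrix (Fin n) (Fin n) F)) (M := r ^ a) fun g hg hgf => by
        rw [hprod] at hgf
        obtain ⟨g', hg', hgg'⟩ := hg.prime.exists_mem_multiset_dvd hgf
        rw [← (hs g' hg').2.2, natDegree_eq_of_degree_eq (degree_eq_degree_of_associated
          (hg.associated_of_dvd (hs g' hg').2.1 hgg'))]
    rw [hT, hrank] at hdvd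
    exact Nat.dvd_of_mul_dvd_mul_right (hf i).2.1.natDegree_pos hdvd
  · intro h
    have hT : aeval T (∏ i, f i) = 0 := by
      have hE : (∑ i, e i) ≠ 0 := fun h0 => by
        have := (Finset.sum_eq_zero_iff.1 h0) ⟨0, hl⟩ (Finset.mem_univ _)
        exact absurd (he ⟨0, hl⟩) (by omega)
      obtain ⟨c, hc⟩ := (hsq.dvd_pow_iff_dvd (y := ∏ i, f i) hE).1 <|
        T.minpoly_dvd_charpoly.trans <| by
          rw [hcharpoly, ← Finset.prod_pow]
          exact Finset.prod_dvd_prod_of_dvd _ _ fun i hi =>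
            pow_dvd_pow _ (Finset.single_le_sum (fun _ _ => Nat.zero_le _) hi)
      rw [hc, map_mul, minpoly.aeval, zero_mul]
    obtain ⟨S, hS⟩ := LinearMap.exists_pow_eq_of_irreducible_dvd_comp (T := T) (M := r ^ a)
      (fun i => (hf i).2.1) hcop' hT fun i => by
        rw [hrank]
        rcases h i with ⟨g, hg, hgf, hgd⟩ | ⟨b, -, hba, ⟨s, hcard, hs, hprod⟩, hbe⟩
        · exact ⟨1, g, hg, hgf, by rw [hgd, one_mul], Nat.mul_dvd_mul_right (one_dvd _) _⟩
        · obtain ⟨g, hg⟩ := Multiset.card_pos_iff_exists_mem.1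
            (hcard ▸ pow_pos hr.pos _ : 0 < Multiset.card s)
          exact ⟨r ^ b, g, (hs g hg).2.1, hprod ▸ Multiset.dvd_prod hg, (hs g hg).2.2,
            Nat.mul_dvd_mul_right hbe _⟩
    have hpow : (LinearMap.toMatrix' S) ^ r ^ a = (α : Matrix (Fin n) (Fin n) F) := by
      apply Matrix.toLin'.injective
      rw [Matrix.toLin'_pow, Matrix.toLin'_toMatrix', hS]
    have hunit : IsUnit (LinearMap.toMatrix' S) :=
      (isUnit_pow_iff (pow_ne_zero a hr.ne_zero)).1 (hpow ▸ α.isUnit)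
    exact ⟨hunit.unit, Units.ext (by rw [Units.val_pow_eq_pow_val, hunit.unit_spec, hpow])⟩
end
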